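/- For every ε > 0 there exists a simple polygon P in the Euclidean plane, each of whose boundary edges has Euclidean length at least 1 (and at most 1 + ε), such that every vertex guard set of P contains two distinct guards g, h with geodesic distance δ(g,h) < ε. In particular, the optimal dispersion distance of a polygon can be arbitrarily small compared to the length of its shortest edge. -/

import Mathlib

open Set Metric
open scoped ENNReal

noncomputable section

/-- The Euclidean plane. -/
abbrev Plane : Type := EuclideanSpace ℝ (Fin 2)

/-- A *simple polygon*: the compact region of the plane bounded by a simple
closed polygonal curve, together with the cyclic sequence of vertices of that
curve.  The field `carrier` is the region (boundary included); the field
`frontier_eq` states that the topological boundary of the region is exactly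
the closed polygonal curve through the vertices, and the fields
`edges_adjacent`/`edges_disjoint` state that this curve is simple. -/
structure SimplePolygon where
  /-- the number of vertices -/
  n : ℕ
  /-- a polygon has at least three vertices -/
  three_le : 3 ≤ n
  /-- the vertices, in cyclic order along the boundary curve -/
  vertex : ZMod n → Plane
  /-- the compact region bounded by the polygonal curve -/
  carrier : Set Plane
  isCompact : IsCompact carrier
  isConnected : IsConnected carrier
  /-- the region is the closure of its interior (it is a genuine
  two-dimensional region) -/
  regular : carrier = closure (interior carrier)
  /-- the topological boundary of the region is the union of the edges of the
  closed polygonal curve through the vertices -/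
  frontier_eq : frontier carrier = ⋃ i : ZMod n, segment ℝ (vertex i) (vertex (i + 1))
  /-- the vertices are pairwise distinct -/
  vertex_injective : Function.Injective vertex
  /-- consecutive edges of the curve meet exactly in their common vertex -/
  edges_adjacent : ∀ i : ZMod n,
    segment ℝ (vertex i) (vertex (i + 1)) ∩ segment ℝ (vertex (i + 1)) (vertex (i + 2)) =
      {vertex (i + 1)}
  /-- non-adjacent edges of the curve are disjoint -/
  edges_disjoint : ∀ i j : ZMod n, i ≠ j → i + 1 ≠ j → j + 1 ≠ i →
    Disjoint (segment ℝ (vertex i) (vertex (i + 1))) (segment ℝ (vertex j) (vertex (j + 1)))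

/-- The geodesic distance between `p` and `q` inside the set `P`: the infimum
of the lengths (total variations) of continuous paths from `p` to `q` staying
in `P`.  (Non-rectifiable paths have length `∞` and hence do not contribute.) -/
def geodesicDist (P : Set Plane) (p q : Plane) : ℝ≥0∞ :=
  ⨅ (γ : ℝ → Plane) (_ : ContinuousOn γ (Icc 0 1)) (_ : γ 0 = p) (_ : γ 1 = q)
    (_ : MapsTo γ (Icc 0 1) P), eVariationOn γ (Icc 0 1)

/-- `p` sees `q` within `P` if the closed segment `[p,q]` is contained in `P`. -/
def Sees (P : Set Plane) (p q : Plane) : Prop :=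
  segment ℝ p q ⊆ P

/-- `G` is a guard set for `P` if `G ⊆ P` and every point of `P` is seen by
some point of `G`. -/
def IsGuardSet (P : Set Plane) (G : Set Plane) : Prop :=
  G ⊆ P ∧ ∀ x ∈ P, ∃ g ∈ G, Sees P g x

/-- A vertex guard set of a simple polygon: a guard set consisting of
vertices of the polygon. -/
def SimplePolygon.IsVertexGuardSet (P : SimplePolygon) (G : Set Plane) : Prop :=
  G ⊆ Set.range P.vertex ∧ IsGuardSet P.carrier G

/-- The dispersion distance of a guard set `G` in `P`: the infimum of the
geodesic distances between pairs of distinct guards. -/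
def dispersionDist (P : Set Plane) (G : Set Plane) : ℝ≥0∞ :=
  ⨅ (g : Plane) (_ : g ∈ G) (h : Plane) (_ : h ∈ G) (_ : g ≠ h), geodesicDist P g h

/-- The vertex `P.vertex i` is *reflex* (interior angle strictly greater than
`180°`): sufficiently close to the vertex, the segment joining a point of the
incoming edge to a point of the outgoing edge (both distinct from the vertex)
always leaves the polygon. -/
def SimplePolygon.IsReflexAt (P : SimplePolygon) (i : ZMod P.n) : Prop :=
  ∃ δ > (0 : ℝ), ∀ a ∈ segment ℝ (P.vertex (i - 1)) (P.vertex i),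
    ∀ c ∈ segment ℝ (P.vertex i) (P.vertex (i + 1)),
      a ≠ P.vertex i → c ≠ P.vertex i →
      dist a (P.vertex i) < δ → dist c (P.vertex i) < δ →
      ¬ segment ℝ a c ⊆ P.carrier

/-- The vertices of `P` are labeled in counterclockwise order: the shoelace
signed area of the vertex cycle is positive. -/
def SimplePolygon.IsCCW (P : SimplePolygon) : Prop :=
  0 < ∑ i ∈ Finset.range P.n,
    (P.vertex (i : ZMod P.n) 0 * P.vertex ((i : ZMod P.n) + 1) 1 -
      P.vertex ((i : ZMod P.n) + 1) 0 * P.vertex (i : ZMod P.n) 1)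


/-- The union of a list of segments. -/
def bd (E : List (Plane × Plane)) : Set Plane := {x | ∃ e ∈ E, x ∈ segment ℝ e.1 e.2}

/-- Two segments meet only in common endpoints. -/
def MeetOk (e f : Plane × Plane) : Prop :=
  ∀ x, x ∈ segment ℝ e.1 e.2 → x ∈ segment ℝ f.1 f.2 →
    (x = e.1 ∨ x = e.2) ∧ (x = f.1 ∨ x = f.2)

/-- A polygonal region with boundary edges `E`. -/
structure PR (A : Set Plane) (E : List (Plane × Plane)) : Prop where
  compact : IsCompact A
  conn : IsConnected A
  reg : A = closure (interior A)
  fr : frontier A = bd E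
  nd : ∀ e ∈ E, e.1 ≠ e.2
  pw : E.Pairwise MeetOk

theorem MeetOk.symm {e f : Plane × Plane} (h : MeetOk e f) : MeetOk f e :=
  fun x hx hy => (h x hy hx).symm

theorem PR.perm {A : Set Plane} {E F : List (Plane × Plane)} (h : PR A E) (p : E.Perm F) :
    PR A F where
  compact := h.compact
  conn := h.conn
  reg := h.reg
  fr := by
    rw [h.fr]; ext x; simp only [bd, mem_ofPred_eq, p.mem_iff]
  nd := fun e he => h.nd e (p.mem_iff.2 he)
  pw := (p.pairwise_iff (fun h => MeetOk.symm h)).1 h.pw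

theorem PR.rot {A : Set Plane} {e : Plane × Plane} {E : List (Plane × Plane)} (h : PR A (e :: E)) :
    PR A (E ++ [e]) :=
  h.perm (List.perm_append_comm (l₁ := [e]))

theorem PR.swap {A : Set Plane} {p q : Plane} {E : List (Plane × Plane)} (h : PR A ((p, q) :: E)) :
    PR A ((q, p) :: E) where
  compact := h.compact
  conn := h.conn
  reg := h.reg
  fr := by
    rw [h.fr]; ext x; simp only [bd, mem_ofPred_eq, List.mem_cons, exists_eq_or_imp]
    rw [segment_symm]
  nd := by
    have := h.nd
    simp only [List.mem_cons, forall_eq_or_imp] at this ⊢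
    exact ⟨this.1.symm, this.2⟩
  pw := by
    have := h.pw
    rw [List.pairwise_cons] at this ⊢
    refine ⟨fun f hf x hx hy => ?_, this.2⟩
    have := this.1 f hf x (by rw [segment_symm]; exact hx) hy
    exact ⟨this.1.symm, this.2⟩

/-- Twice the signed area of the triangle `p q y`. -/
def cr (p q y : Plane) : ℝ := (q 0 - p 0) * (y 1 - p 1) - (q 1 - p 1) * (y 0 - p 0)

theorem cr_cont (p q : Plane) : Continuous (cr p q) := by
  unfold cr; fun_prop

theorem plane_ext {p q : Plane} (h0 : p 0 = q 0) (h1 : p 1 = q 1) : p = q := by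
  ext i; fin_cases i
  · exact h0
  · exact h1

theorem cr_comb (p q x y : Plane) (s t : ℝ) (h : s + t = 1) :
    cr p q (s • x + t • y) = s * cr p q x + t * cr p q y := by
  have : s = 1 - t := by linarith
  subst this
  simp only [cr, PiLp.add_apply, PiLp.smul_apply, smul_eq_mul]; ring

/-- Near a point of the line there are points strictly on both sides. -/
theorem cr_near {p q y : Plane} (hpq : p ≠ q) (hy : cr p q y = 0) {V : Set Plane} (hV : IsOpen V)
    (hyV : y ∈ V) : (∃ z ∈ V, 0 < cr p q z) ∧ ∃ z ∈ V, cr p q z < 0 := by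
  let n : Plane := !₂[-(q 1 - p 1), q 0 - p 0]
  have hc : 0 < (q 0 - p 0) ^ 2 + (q 1 - p 1) ^ 2 := by
    by_contra hcon
    have h0 : (q 0 - p 0) ^ 2 = 0 := by nlinarith [sq_nonneg (q 0 - p 0), sq_nonneg (q 1 - p 1)]
    have h1 : (q 1 - p 1) ^ 2 = 0 := by nlinarith [sq_nonneg (q 0 - p 0), sq_nonneg (q 1 - p 1)]
    have h0' := pow_eq_zero_iff (two_ne_zero) |>.1 h0
    have h1' := pow_eq_zero_iff (two_ne_zero) |>.1 h1
    exact hpq (plane_ext (by linarith) (by linarith))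
  have key : ∀ t : ℝ, cr p q (y + t • n) = t * ((q 0 - p 0) ^ 2 + (q 1 - p 1) ^ 2) := by
    intro t
    have : cr p q (y + t • n) = cr p q y + t * ((q 0 - p 0) ^ 2 + (q 1 - p 1) ^ 2) := by
      simp [cr, n]; ring
    rw [this, hy, zero_add]
  have hcont : Continuous (fun t : ℝ => y + t • n) := by fun_prop
  have hopen : IsOpen ((fun t : ℝ => y + t • n) ⁻¹' V) := hV.preimage hcont
  obtain ⟨r, hr, hball⟩ := Metric.isOpen_iff.1 hopen 0 (by simpa using hyV)
  refine ⟨⟨y + (r / 2) • n, hball ?_, ?_⟩, ⟨y + (-(r / 2)) • n, hball ?_, ?_⟩⟩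
  · simp [abs_of_pos hr, hr]
  · rw [key]; positivity
  · simp [abs_of_pos hr, hr]
  · rw [key]; nlinarith

theorem cr_segment {p q x : Plane} (h : x ∈ segment ℝ p q) : cr p q x = 0 := by
  obtain ⟨s, t, _, _, hst, rfl⟩ := h
  rw [cr_comb _ _ _ _ _ _ hst]; simp [cr]; right; ring

theorem bd_closed (E : List (Plane × Plane)) : IsClosed (bd E) := by
  induction E with
  | nil => simp [bd]
  | cons e E ih =>
    have : bd (e :: E) = segment ℝ e.1 e.2 ∪ bd E := by
      ext x; simp [bd]
    rw [this]
    refine IsClosed.union ?_ ih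
    rw [← convexHull_pair]
    exact ((Set.toFinite {e.1, e.2}).isCompact_convexHull (𝕜 := ℝ)).isClosed

theorem dichotomy {A S : Set Plane} (hA : IsClosed A) (hS : IsPreconnected S)
    (h : ∀ x ∈ S, x ∉ frontier A) : S ⊆ interior A ∨ S ⊆ Aᶜ := by
  refine hS.subset_or_subset isOpen_interior hA.isOpen_compl ?_ ?_
  · exact disjoint_compl_right.mono_left interior_subset
  · intro x hx
    by_cases hxA : x ∈ A
    · left
      by_contra hi
      exact h x hx (by rw [hA.frontier_eq]; exact ⟨hxA, hi⟩)
    · right; exact hxA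

theorem half_pos_conv (p q x : Plane) (r : ℝ) : IsPreconnected (ball x r ∩ {y | 0 < cr p q y}) := by
  refine Convex.isPreconnected ((convex_ball x r).inter ?_)
  intro y hy z hz s t hs ht hst
  simp only [mem_ofPred_eq] at *
  rw [cr_comb _ _ _ _ _ _ hst]
  rcases eq_or_lt_of_le hs with h | h
  · have : t = 1 := by linarith
    subst h; subst this; simpa using hz
  · have := mul_pos h hy
    have := mul_nonneg ht hz.le
    linarith

theorem half_neg_conv (p q x : Plane) (r : ℝ) : IsPreconnected (ball x r ∩ {y | cr p q y < 0}) := by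
  have : {y | cr p q y < 0} = {y | 0 < cr q p y} := by
    ext y
    have : cr q p y = - cr p q y := by simp only [cr]; ring
    simp [this]
  rw [this]
  exact half_pos_conv q p x r

/-- One of the two open half discs lies in the region. -/
theorem half_in {A : Set Plane} {E : List (Plane × Plane)} {p q x : Plane} {r : ℝ}
    (hA : PR A ((p, q) :: E)) (hr : 0 < r) (hx : x ∈ segment ℝ p q)
    (hU : ∀ y ∈ ball x r, y ∉ bd E) :
    ball x r ∩ {y | 0 < cr p q y} ⊆ A ∨ ball x r ∩ {y | cr p q y < 0} ⊆ A := by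
  have hcl := hA.compact.isClosed
  have hpq : p ≠ q := hA.nd _ List.mem_cons_self
  have hfr : ∀ y ∈ ball x r, cr p q y ≠ 0 → y ∉ frontier A := by
    intro y hy hne hf
    rw [hA.fr] at hf
    obtain ⟨e, he, hye⟩ := hf
    rcases List.mem_cons.1 he with rfl | he
    · exact hne (cr_segment hye)
    · exact hU y hy ⟨e, he, hye⟩
  have h1 := dichotomy hcl (half_pos_conv p q x r) (fun y hy => hfr y hy.1 hy.2.ne')
  have h2 := dichotomy hcl (half_neg_conv p q x r) (fun y hy => hfr y hy.1 hy.2.ne)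
  rcases h1 with h1 | h1
  · exact Or.inl (h1.trans interior_subset)
  rcases h2 with h2 | h2
  · exact Or.inr (h2.trans interior_subset)
  exfalso
  have hxA : x ∈ frontier A := by rw [hA.fr]; exact ⟨_, List.mem_cons_self, hx⟩
  have hxA' : x ∈ A := hcl.frontier_subset hxA
  rw [hA.reg] at hxA'
  obtain ⟨y, hyU, hyA⟩ := mem_closure_iff.1 hxA' (ball x r) isOpen_ball (mem_ball_self hr)
  rcases lt_trichotomy (cr p q y) 0 with h | h | h
  · exact h2 ⟨hyU, h⟩ (interior_subset hyA)
  · obtain ⟨z, hz, hz'⟩ := (cr_near hpq h (isOpen_ball.inter isOpen_interior) ⟨hyU, hyA⟩).1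
    exact h1 ⟨hz.1, hz'⟩ (interior_subset hz.2)
  · exact h1 ⟨hyU, h⟩ (interior_subset hyA)

theorem open_ne {p q x : Plane} (hpq : p ≠ q) (hx : x ∈ openSegment ℝ p q) : x ≠ p ∧ x ≠ q := by
  constructor
  · rintro rfl; exact hpq (left_mem_openSegment_iff.1 hx)
  · rintro rfl; exact hpq (right_mem_openSegment_iff.1 hx)

theorem glue_interior {A B : Set Plane} {E F : List (Plane × Plane)} {p q x : Plane}
    (hA : PR A ((p, q) :: E)) (hB : PR B ((p, q) :: F)) (hAB : A ∩ B ⊆ segment ℝ p q)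
    (hx : x ∈ openSegment ℝ p q) : x ∈ interior (A ∪ B) := by
  have hpq : p ≠ q := hA.nd _ List.mem_cons_self
  have hxs := openSegment_subset_segment _ _ _ hx
  have hne := open_ne hpq hx
  have hE : x ∉ bd E := by
    rintro ⟨e, he, hxe⟩
    have := ((List.pairwise_cons.1 hA.pw).1 e he x hxs hxe).1
    tauto
  have hF : x ∉ bd F := by
    rintro ⟨e, he, hxe⟩
    have := ((List.pairwise_cons.1 hB.pw).1 e he x hxs hxe).1
    tauto
  obtain ⟨r, hr, hball⟩ := Metric.isOpen_iff.1
    ((bd_closed E).isOpen_compl.inter (bd_closed F).isOpen_compl) x ⟨hE, hF⟩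
  have h1 := half_in hA hr hxs (fun y hy => (hball hy).1)
  have h2 := half_in hB hr hxs (fun y hy => (hball hy).2)
  have hnear := cr_near hpq (cr_segment hxs) isOpen_ball (mem_ball_self (x := x) hr)
  obtain ⟨⟨z, hz, hz0⟩, ⟨w, hw, hw0⟩⟩ := hnear
  have hall : ball x r ∩ {y | cr p q y ≠ 0} ⊆ A ∪ B := by
    rintro y ⟨hy, hy0⟩
    rcases h1 with h1 | h1 <;> rcases h2 with h2 | h2
    · exact absurd (cr_segment (hAB ⟨h1 ⟨hz, hz0⟩, h2 ⟨hz, hz0⟩⟩)) hz0.ne'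
    · rcases lt_or_gt_of_ne hy0 with h | h
      · exact Or.inr (h2 ⟨hy, h⟩)
      · exact Or.inl (h1 ⟨hy, h⟩)
    · rcases lt_or_gt_of_ne hy0 with h | h
      · exact Or.inl (h1 ⟨hy, h⟩)
      · exact Or.inr (h2 ⟨hy, h⟩)
    · exact absurd (cr_segment (hAB ⟨h1 ⟨hw, hw0⟩, h2 ⟨hw, hw0⟩⟩)) hw0.ne
  have hclosed : IsClosed (A ∪ B) := hA.compact.isClosed.union hB.compact.isClosed
  refine mem_interior.2 ⟨ball x r, ?_, isOpen_ball, mem_ball_self hr⟩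
  intro y hy
  by_contra hcon
  by_cases hy0 : cr p q y = 0
  · obtain ⟨z, hz, hz0⟩ :=
      (cr_near hpq hy0 (isOpen_ball.inter hclosed.isOpen_compl) ⟨hy, hcon⟩).1
    exact hz.2 (hall ⟨hz.1, hz0.ne'⟩)
  · exact hcon (hall ⟨hy, hy0⟩)

theorem frontier_keep {A B : Set Plane} {E F : List (Plane × Plane)} {p q : Plane}
    (hA : PR A ((p, q) :: E)) (hB : PR B ((p, q) :: F)) (hAB : A ∩ B ⊆ segment ℝ p q) :
    bd E ⊆ frontier (A ∪ B) := by
  rintro x ⟨e, he, hx⟩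
  rw [← closure_openSegment] at hx
  refine closure_minimal ?_ isClosed_frontier hx
  clear hx x
  intro x hx
  have hne := open_ne (hA.nd e (List.mem_cons_of_mem _ he)) hx
  have hxs := openSegment_subset_segment _ _ _ hx
  have hfA : x ∈ frontier A := by rw [hA.fr]; exact ⟨e, List.mem_cons_of_mem _ he, hxs⟩
  have hxA : x ∈ A := hA.compact.isClosed.frontier_subset hfA
  have hxB : x ∉ B := by
    intro hxB
    have := ((List.pairwise_cons.1 hA.pw).1 e he x (hAB ⟨hxA, hxB⟩) hxs).2
    tauto
  have hclosed : IsClosed (A ∪ B) := hA.compact.isClosed.union hB.compact.isClosed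
  rw [hclosed.frontier_eq]
  refine ⟨Or.inl hxA, fun hi => ?_⟩
  rw [hA.compact.isClosed.frontier_eq] at hfA
  refine hfA.2 (mem_interior.2 ⟨interior (A ∪ B) ∩ Bᶜ, ?_,
    isOpen_interior.inter hB.compact.isClosed.isOpen_compl, hi, hxB⟩)
  rintro y ⟨hy, hyB⟩
  exact (interior_subset hy).resolve_right hyB

theorem glue {A B : Set Plane} {E F : List (Plane × Plane)} {p q : Plane}
    (hA : PR A ((p, q) :: E)) (hB : PR B ((p, q) :: F)) (hAB : A ∩ B ⊆ segment ℝ p q)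
    (hp : p ∈ bd (E ++ F)) (hq : q ∈ bd (E ++ F)) : PR (A ∪ B) (E ++ F) where
  compact := hA.compact.union hB.compact
  conn := by
    refine IsConnected.union ⟨p, ?_, ?_⟩ hA.conn hB.conn
    · apply hA.compact.isClosed.frontier_subset; rw [hA.fr]
      exact ⟨_, List.mem_cons_self, left_mem_segment _ _ _⟩
    · apply hB.compact.isClosed.frontier_subset; rw [hB.fr]
      exact ⟨_, List.mem_cons_self, left_mem_segment _ _ _⟩
  reg := by
    have hclosed : IsClosed (A ∪ B) := hA.compact.isClosed.union hB.compact.isClosed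
    apply Subset.antisymm
    · apply union_subset
      · conv_lhs => rw [hA.reg]
        exact closure_mono (interior_mono subset_union_left)
      · conv_lhs => rw [hB.reg]
        exact closure_mono (interior_mono subset_union_right)
    · exact closure_minimal interior_subset hclosed
  fr := by
    have hbd : bd (E ++ F) = bd E ∪ bd F := by
      ext x; simp only [bd, List.mem_append, mem_ofPred_eq, mem_union]
      constructor
      · rintro ⟨e, he | he, hx⟩
        · exact Or.inl ⟨e, he, hx⟩
        · exact Or.inr ⟨e, he, hx⟩
      · rintro (⟨e, he, hx⟩ | ⟨e, he, hx⟩)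
        · exact ⟨e, Or.inl he, hx⟩
        · exact ⟨e, Or.inr he, hx⟩
    apply Subset.antisymm
    · intro x hx
      have hseg : x ∈ segment ℝ p q → x ∈ bd (E ++ F) := by
        intro hs
        rw [← insert_endpoints_openSegment] at hs
        rcases hs with rfl | rfl | hs
        · exact hp
        · exact hq
        · exact absurd (glue_interior hA hB hAB hs) hx.2
      rcases (frontier_union_subset A B) hx with h | h
      · have := h.1; rw [hA.fr] at this
        obtain ⟨e, he, hxe⟩ := this
        rcases List.mem_cons.1 he with rfl | he
        · exact hseg hxe
        · rw [hbd]; exact Or.inl ⟨e, he, hxe⟩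
      · have := h.2; rw [hB.fr] at this
        obtain ⟨e, he, hxe⟩ := this
        rcases List.mem_cons.1 he with rfl | he
        · exact hseg hxe
        · rw [hbd]; exact Or.inr ⟨e, he, hxe⟩
    · rw [hbd]
      refine union_subset (frontier_keep hA hB hAB) ?_
      rw [union_comm]
      exact frontier_keep hB hA (by rw [inter_comm]; exact hAB)
  nd := by
    intro e he
    rcases List.mem_append.1 he with he | he
    · exact hA.nd e (List.mem_cons_of_mem _ he)
    · exact hB.nd e (List.mem_cons_of_mem _ he)
  pw := by
    have h1 := List.pairwise_cons.1 hA.pw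
    have h2 := List.pairwise_cons.1 hB.pw
    refine List.pairwise_append.2 ⟨h1.2, h2.2, fun e he f hf x hx hy => ?_⟩
    have hxA : x ∈ A := by
      apply hA.compact.isClosed.frontier_subset; rw [hA.fr]
      exact ⟨e, List.mem_cons_of_mem _ he, hx⟩
    have hxB : x ∈ B := by
      apply hB.compact.isClosed.frontier_subset; rw [hB.fr]
      exact ⟨f, List.mem_cons_of_mem _ hf, hy⟩
    have hs := hAB ⟨hxA, hxB⟩
    exact ⟨(h1.1 e he x hs hx).2, (h2.1 f hf x hs hy).2⟩


/-- The closed triangle with the given corners. -/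
def tri (p q r : Plane) : Set Plane := convexHull ℝ {p, q, r}

theorem mem_tri {p q r x : Plane} : x ∈ tri p q r ↔
    ∃ α β γ : ℝ, 0 ≤ α ∧ 0 ≤ β ∧ 0 ≤ γ ∧ α + β + γ = 1 ∧ x = α • p + β • q + γ • r := by
  unfold tri
  constructor
  · intro h
    have hsub : convexHull ℝ {p, q, r} ⊆ {x : Plane | ∃ α β γ : ℝ, 0 ≤ α ∧ 0 ≤ β ∧ 0 ≤ γ ∧
        α + β + γ = 1 ∧ x = α • p + β • q + γ • r} := by
      apply convexHull_min
      · rintro y (rfl | rfl | rfl)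
        · exact ⟨1, 0, 0, by norm_num, by norm_num, by norm_num, by norm_num, by simp⟩
        · exact ⟨0, 1, 0, by norm_num, by norm_num, by norm_num, by norm_num, by simp⟩
        · exact ⟨0, 0, 1, by norm_num, by norm_num, by norm_num, by norm_num, by simp⟩
      · rintro y ⟨a, b, c, ha, hb, hc, h1, rfl⟩ z ⟨a', b', c', ha', hb', hc', h1', rfl⟩ s t hs ht hst
        refine ⟨s * a + t * a', s * b + t * b', s * c + t * c', by positivity, by positivity,
          by positivity, ?_, by module⟩
        linear_combination s * h1 + t * h1' + hst
    exact hsub h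
  · rintro ⟨α, β, γ, hα, hβ, hγ, h1, rfl⟩
    have hc := convex_convexHull ℝ ({p, q, r} : Set Plane)
    have := hc.sum_mem (t := Finset.univ) (w := ![α, β, γ]) (z := ![p, q, r])
      (by intro i _; fin_cases i <;> simpa) (by simp [Fin.sum_univ_three, h1])
      (by intro i _; apply subset_convexHull; fin_cases i <;> simp)
    simpa [Fin.sum_univ_three] using this

theorem tri_cr {p q r : Plane} (h : 0 < cr p q r) {x : Plane} : x ∈ tri p q r ↔
    0 ≤ cr p q x ∧ 0 ≤ cr q r x ∧ 0 ≤ cr r p x := by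
  rw [mem_tri]
  constructor
  · rintro ⟨α, β, γ, hα, hβ, hγ, h1, rfl⟩
    have h2 : α = 1 - β - γ := by linarith
    have e1 : cr p q (α • p + β • q + γ • r) = γ * cr p q r := by
      subst h2; simp only [cr, PiLp.add_apply, PiLp.smul_apply, smul_eq_mul]; ring
    have e2 : cr q r (α • p + β • q + γ • r) = α * cr p q r := by
      subst h2; simp only [cr, PiLp.add_apply, PiLp.smul_apply, smul_eq_mul]; ring
    have e3 : cr r p (α • p + β • q + γ • r) = β * cr p q r := by
      subst h2; simp only [cr, PiLp.add_apply, PiLp.smul_apply, smul_eq_mul]; ring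
    rw [e1, e2, e3]
    exact ⟨by positivity, by positivity, by positivity⟩
  · rintro ⟨h1, h2, h3⟩
    refine ⟨cr q r x / cr p q r, cr r p x / cr p q r, cr p q x / cr p q r, by positivity,
      by positivity, by positivity, ?_, ?_⟩
    · field_simp; simp only [cr]; ring
    · have h' := h.ne'
      apply plane_ext <;>
      · simp only [PiLp.add_apply, PiLp.smul_apply, smul_eq_mul]
        field_simp
        simp only [cr]; ring

theorem seg_of_cr {p q r x : Plane} (h : 0 < cr p q r) (h1 : cr p q x = 0)
    (h2 : 0 ≤ cr q r x) (h3 : 0 ≤ cr r p x) : x ∈ segment ℝ p q := by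
  have h' := h.ne'
  refine ⟨cr q r x / cr p q r, cr r p x / cr p q r, by positivity, by positivity, ?_, ?_⟩
  · have : cr q r x + cr r p x = cr p q r - cr p q x := by simp only [cr]; ring
    rw [← add_div, this, h1, sub_zero, div_self h']
  · have key0 : cr q r x * p 0 + cr r p x * q 0 + cr p q x * r 0 = cr p q r * x 0 := by
      simp only [cr]; ring
    have key1 : cr q r x * p 1 + cr r p x * q 1 + cr p q x * r 1 = cr p q r * x 1 := by
      simp only [cr]; ring
    apply plane_ext
    · simp only [PiLp.add_apply, PiLp.smul_apply, smul_eq_mul]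
      field_simp
      rw [← key0, h1]; ring
    · simp only [PiLp.add_apply, PiLp.smul_apply, smul_eq_mul]
      field_simp
      rw [← key1, h1]; ring

theorem cr_rot (p q r : Plane) : cr q r p = cr p q r := by
  simp only [cr]; ring

theorem ne_of_cr {p q r : Plane} (h : 0 < cr p q r) : p ≠ q := by
  rintro rfl; simp [cr] at h

/-- In a nondegenerate triangle two sides meet only in the common corner. -/
theorem tri_meet {p q r : Plane} (h : 0 < cr p q r) : MeetOk (p, q) (q, r) := by
  intro x hx hy
  have h1 := cr_segment hx
  have h2 := cr_segment hy
  simp only at h1 h2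
  have key0 : cr q r x * p 0 + (cr p q r - cr p q x - cr q r x) * q 0 + cr p q x * r 0
      = cr p q r * x 0 := by simp only [cr]; ring
  have key1 : cr q r x * p 1 + (cr p q r - cr p q x - cr q r x) * q 1 + cr p q x * r 1
      = cr p q r * x 1 := by simp only [cr]; ring
  rw [h1, h2] at key0 key1
  have : x = q := by
    apply plane_ext
    · apply mul_left_cancel₀ h.ne'; linarith
    · apply mul_left_cancel₀ h.ne'; linarith
  subst this
  simp

theorem PR_tri {p q r : Plane} (h : 0 < cr p q r) : PR (tri p q r) [(p, q), (q, r), (r, p)] := by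
  have h2 : 0 < cr q r p := by rw [cr_rot]; exact h
  have h3 : 0 < cr r p q := by rw [cr_rot]; exact h2
  have hcomp : IsCompact (tri p q r) := (Set.toFinite _).isCompact_convexHull (𝕜 := ℝ)
  have hconv : Convex ℝ (tri p q r) := convex_convexHull _ _
  have hset : tri p q r = {x | 0 ≤ cr p q x ∧ 0 ≤ cr q r x ∧ 0 ≤ cr r p x} := by
    ext x; exact tri_cr h
  have hint : interior (tri p q r) = {x | 0 < cr p q x ∧ 0 < cr q r x ∧ 0 < cr r p x} := by
    apply Subset.antisymm
    · intro x hx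
      have hx' := interior_subset hx
      rw [hset] at hx'
      have aux : ∀ u v : Plane, u ≠ v → 0 ≤ cr u v x →
          (∀ y ∈ tri p q r, 0 ≤ cr u v y) → 0 < cr u v x := by
        intro u v huv h0 hall
        rcases eq_or_lt_of_le h0 with h0 | h0
        · obtain ⟨z, hz, hz0⟩ := (cr_near huv h0.symm isOpen_interior hx).2
          exact absurd (hall z (interior_subset hz)) (not_le.2 hz0)
        · exact h0
      refine ⟨aux p q (ne_of_cr h) hx'.1 fun y hy => (tri_cr h).1 hy |>.1,
        aux q r (ne_of_cr h2) hx'.2.1 fun y hy => (tri_cr h).1 hy |>.2.1,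
        aux r p (ne_of_cr h3) hx'.2.2 fun y hy => (tri_cr h).1 hy |>.2.2⟩
    · apply interior_maximal
      · rintro x ⟨a, b, c⟩; exact (tri_cr h).2 ⟨a.le, b.le, c.le⟩
      · exact (isOpen_lt continuous_const (cr_cont p q)).inter
          ((isOpen_lt continuous_const (cr_cont q r)).inter
            (isOpen_lt continuous_const (cr_cont r p)))
  have hne : (interior (tri p q r)).Nonempty := by
    rw [hint]
    refine ⟨(1 / 3 : ℝ) • p + (1 / 3 : ℝ) • q + (1 / 3 : ℝ) • r, ?_, ?_, ?_⟩
    · have : cr p q ((1 / 3 : ℝ) • p + (1 / 3 : ℝ) • q + (1 / 3 : ℝ) • r) = cr p q r / 3 := by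
        simp only [cr, PiLp.add_apply, PiLp.smul_apply, smul_eq_mul]; ring
      rw [this]; positivity
    · have : cr q r ((1 / 3 : ℝ) • p + (1 / 3 : ℝ) • q + (1 / 3 : ℝ) • r) = cr p q r / 3 := by
        simp only [cr, PiLp.add_apply, PiLp.smul_apply, smul_eq_mul]; ring
      rw [this]; positivity
    · have : cr r p ((1 / 3 : ℝ) • p + (1 / 3 : ℝ) • q + (1 / 3 : ℝ) • r) = cr p q r / 3 := by
        simp only [cr, PiLp.add_apply, PiLp.smul_apply, smul_eq_mul]; ring
      rw [this]; positivity
  refine ⟨hcomp, ?_, ?_, ?_, ?_, ?_⟩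
  · exact hconv.isConnected (hne.mono interior_subset)
  · rw [hconv.closure_interior_eq_closure_of_nonempty_interior hne, hcomp.isClosed.closure_eq]
  · rw [hcomp.isClosed.frontier_eq]
    ext x
    simp only [mem_sdiff, hint, tri_cr h, bd, List.mem_cons, List.not_mem_nil, or_false]
    constructor
    · rintro ⟨⟨a, b, c⟩, hn⟩
      rcases eq_or_lt_of_le a with a' | a'
      · exact ⟨_, Or.inl rfl, seg_of_cr h a'.symm b c⟩
      rcases eq_or_lt_of_le b with b' | b'
      · exact ⟨_, Or.inr (Or.inl rfl), seg_of_cr h2 b'.symm c a⟩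
      rcases eq_or_lt_of_le c with c' | c'
      · exact ⟨_, Or.inr (Or.inr rfl), seg_of_cr h3 c'.symm a b⟩
      exact absurd ⟨a', b', c'⟩ hn
    · rintro ⟨e, he, hx⟩
      have hp : p ∈ tri p q r := subset_convexHull _ _ (by simp)
      have hq : q ∈ tri p q r := subset_convexHull _ _ (by simp)
      have hr : r ∈ tri p q r := subset_convexHull _ _ (by simp)
      rcases he with rfl | rfl | rfl
      · refine ⟨(tri_cr h).1 (hconv.segment_subset hp hq hx), fun hn => ?_⟩
        exact hn.1.ne' (cr_segment hx)
      · refine ⟨(tri_cr h).1 (hconv.segment_subset hq hr hx), fun hn => ?_⟩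
        exact hn.2.1.ne' (cr_segment hx)
      · refine ⟨(tri_cr h).1 (hconv.segment_subset hr hp hx), fun hn => ?_⟩
        exact hn.2.2.ne' (cr_segment hx)
  · simp [ne_of_cr h, ne_of_cr h2, ne_of_cr h3]
  · simp [tri_meet h, tri_meet h2, (tri_meet h3).symm]

/-- Gluing a triangle to a region along a boundary edge. -/
theorem glueTri {A : Set Plane} {E : List (Plane × Plane)} {p q r : Plane}
    (hA : PR A ((p, q) :: E)) (h : 0 < cr q p r) (hs : A ∩ tri q p r ⊆ segment ℝ p q) :
    PR (A ∪ tri q p r) (E ++ [(p, r), (r, q)]) := by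
  refine glue hA (PR_tri h).swap hs ?_ ?_
  · exact ⟨(p, r), by simp, left_mem_segment _ _ _⟩
  · exact ⟨(r, q), by simp, right_mem_segment _ _ _⟩

theorem PR.smul {A : Set Plane} {E : List (Plane × Plane)} (h : PR A E) {c : ℝ} (hc : c ≠ 0) :
    PR ((fun x => c • x) '' A) (E.map (fun e => (c • e.1, c • e.2))) := by
  let φ : Plane ≃ₜ Plane := Homeomorph.smulOfNeZero c hc
  have hφ : (fun x : Plane => c • x) = φ := rfl
  have himg : ∀ u v : Plane, segment ℝ (c • u) (c • v) = φ '' segment ℝ u v := by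
    intro u v
    ext x
    constructor
    · rintro ⟨s, t, hs, ht, hst, rfl⟩
      refine ⟨s • u + t • v, ⟨s, t, hs, ht, hst, rfl⟩, ?_⟩
      rw [← hφ]; simp only; module
    · rintro ⟨y, ⟨s, t, hs, ht, hst, rfl⟩, rfl⟩
      refine ⟨s, t, hs, ht, hst, ?_⟩
      rw [← hφ]; simp only; module
  rw [hφ]
  refine ⟨h.compact.image φ.continuous, h.conn.image _ φ.continuous.continuousOn, ?_, ?_, ?_, ?_⟩
  · rw [← φ.image_interior, ← φ.image_closure, ← h.reg]
  · rw [← φ.image_frontier, h.fr]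
    ext x
    simp only [bd, mem_image, List.mem_map, mem_ofPred_eq]
    constructor
    · rintro ⟨y, ⟨e, he, hy⟩, rfl⟩
      exact ⟨_, ⟨e, he, rfl⟩, by rw [himg]; exact ⟨y, hy, rfl⟩⟩
    · rintro ⟨_, ⟨e, he, rfl⟩, hx⟩
      rw [himg] at hx
      obtain ⟨y, hy, rfl⟩ := hx
      exact ⟨y, ⟨e, he, hy⟩, rfl⟩
  · intro e he
    obtain ⟨f, hf, rfl⟩ := List.mem_map.1 he
    exact fun heq => h.nd f hf (φ.injective heq)
  · refine h.pw.map _ ?_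
    intro e f hef x hx hy
    rw [himg] at hx hy
    obtain ⟨y, hy1, rfl⟩ := hx
    obtain ⟨z, hz1, hzy⟩ := hy
    have := φ.injective hzy
    subst this
    have := hef z hy1 hz1
    refine ⟨this.1.imp ?_ ?_, this.2.imp ?_ ?_⟩ <;> · rintro rfl; rfl


/-- The vertex a. -/
def va (k : ℝ) : Plane := !₂[-325 * k + 4, -10]

/-- The vertex b. -/
def vb (k : ℝ) : Plane := !₂[-325 * k + 2, -8]

/-- The vertex c. -/
def vc (k : ℝ) : Plane := !₂[-325 * k, 0]

/-- The vertex d. -/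
def vd (k : ℝ) : Plane := !₂[-325 * k, 8]

/-- The vertex e. -/
def ve (k : ℝ) : Plane := !₂[-325 * k - 10, 0]

/-- The witness point w. -/
def vw (k : ℝ) : Plane := !₂[-325 * k - 1, 6]

/-- First spike tip. -/
def s1 (k : ℝ) : Plane := !₂[-75 * k, 600 * k]

/-- Second spike tip. -/
def s2 (k : ℝ) : Plane := !₂[-143 * k, 624 * k + 8]

/-- Third spike tip. -/
def s3 (k : ℝ) : Plane := !₂[-845 * k - 10, -390 * k]

/-- Fourth spike tip. -/
def s4 (k : ℝ) : Plane := !₂[-75 * k, -600 * k]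

set_option linter.unusedSimpArgs false
set_option linter.unusedVariables false

theorem coords (k : ℝ) : va k 0 = -325 * k + 4 ∧ va k 1 = -10 ∧
    vb k 0 = -325 * k + 2 ∧ vb k 1 = -8 ∧
    vc k 0 = -325 * k ∧ vc k 1 = 0 ∧
    vd k 0 = -325 * k ∧ vd k 1 = 8 ∧
    ve k 0 = -325 * k - 10 ∧ ve k 1 = 0 ∧
    vw k 0 = -325 * k - 1 ∧ vw k 1 = 6 ∧
    s1 k 0 = -75 * k ∧ s1 k 1 = 600 * k ∧
    s2 k 0 = -143 * k ∧ s2 k 1 = 624 * k + 8 ∧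
    s3 k 0 = -845 * k - 10 ∧ s3 k 1 = -390 * k ∧
    s4 k 0 = -75 * k ∧ s4 k 1 = -600 * k := by
  refine ⟨rfl, rfl, rfl, rfl, rfl, rfl, rfl, rfl, rfl, rfl, rfl, rfl, rfl, rfl, rfl, rfl, rfl, rfl, rfl, rfl⟩

theorem fun_tri {α β y0 y1 M : ℝ} {p q r y : Plane} (h : y ∈ tri p q r) (h0 : y 0 = y0) (h1 : y 1 = y1)
    (hp : α * p 0 + β * p 1 ≤ M) (hq : α * q 0 + β * q 1 ≤ M) (hr : α * r 0 + β * r 1 ≤ M) :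
    α * y0 + β * y1 ≤ M := by
  obtain ⟨a, b, c, ha, hb, hc, h1, rfl⟩ := mem_tri.1 h
  subst h0; subst h1
  simp only [PiLp.add_apply, PiLp.smul_apply, smul_eq_mul]
  have := mul_le_mul_of_nonneg_left hp ha
  have := mul_le_mul_of_nonneg_left hq hb
  have := mul_le_mul_of_nonneg_left hr hc
  have e : a * M + b * M + c * M = M := by rw [← add_mul, ← add_mul, ‹a + b + c = 1›, one_mul]
  linarith

/-- Separation of a point from a triangle by a linear functional. -/
theorem not_tri (α β : ℝ) {p q r y : Plane}
    (h : α * p 0 + β * p 1 < α * y 0 + β * y 1 ∧ α * q 0 + β * q 1 < α * y 0 + β * y 1 ∧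
      α * r 0 + β * r 1 < α * y 0 + β * y 1) : y ∉ tri p q r := by
  intro hy
  obtain ⟨a, b, c, ha, hb, hc, h1, h2⟩ := mem_tri.1 hy
  have e0 : y 0 = a * p 0 + b * q 0 + c * r 0 := by rw [h2]; simp
  have e1 : y 1 = a * p 1 + b * q 1 + c * r 1 := by rw [h2]; simp
  obtain ⟨hp, hq, hr⟩ := h
  set M := α * y 0 + β * y 1 with hM
  have e : a * (M - (α * p 0 + β * p 1)) + b * (M - (α * q 0 + β * q 1)) +
      c * (M - (α * r 0 + β * r 1)) = 0 := by
    have : a * M + b * M + c * M = M := by rw [← add_mul, ← add_mul, h1, one_mul]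
    have e2 : M = α * (a * p 0 + b * q 0 + c * r 0) + β * (a * p 1 + b * q 1 + c * r 1) := by
      rw [hM, ← e0, ← e1]
    linear_combination this + e2
  have p1 := mul_nonneg ha (sub_nonneg.2 hp.le)
  have p2 := mul_nonneg hb (sub_nonneg.2 hq.le)
  have p3 := mul_nonneg hc (sub_nonneg.2 hr.le)
  have z1 : a = 0 := by
    rcases mul_eq_zero.1 (show a * (M - (α * p 0 + β * p 1)) = 0 by linarith) with h | h
    · exact h
    · linarith
  have z2 : b = 0 := by
    rcases mul_eq_zero.1 (show b * (M - (α * q 0 + β * q 1)) = 0 by linarith) with h | h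
    · exact h
    · linarith
  have z3 : c = 0 := by
    rcases mul_eq_zero.1 (show c * (M - (α * r 0 + β * r 1)) = 0 by linarith) with h | h
    · exact h
    · linarith
  linarith

/-- Two triangles separated by a linear functional meet in a common side only. -/
theorem sep (α β : ℝ) {x1 x2 x3 p q r y : Plane} (hX : y ∈ tri x1 x2 x3) (hB : y ∈ tri q p r)
    (h1 : α * x1 0 + β * x1 1 ≤ α * p 0 + β * p 1 ∧ α * x2 0 + β * x2 1 ≤ α * p 0 + β * p 1 ∧
      α * x3 0 + β * x3 1 ≤ α * p 0 + β * p 1)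
    (h2 : α * x1 0 + β * x1 1 ≤ α * q 0 + β * q 1 ∧ α * x2 0 + β * x2 1 ≤ α * q 0 + β * q 1 ∧
      α * x3 0 + β * x3 1 ≤ α * q 0 + β * q 1)
    (h3 : α * x1 0 + β * x1 1 < α * r 0 + β * r 1 ∧ α * x2 0 + β * x2 1 < α * r 0 + β * r 1 ∧
      α * x3 0 + β * x3 1 < α * r 0 + β * r 1) : y ∈ segment ℝ p q := by
  obtain ⟨a, b, c, ha, hb, hc, hs, h⟩ := mem_tri.1 hB
  have f1 := fun_tri hX rfl rfl h1.1 h1.2.1 h1.2.2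
  have f2 := fun_tri hX rfl rfl h2.1 h2.2.1 h2.2.2
  have f3 : α * y 0 + β * y 1 < α * r 0 + β * r 1 := by
    by_contra hcon
    exact not_tri α β ⟨by linarith [h3.1], by linarith [h3.2.1], by linarith [h3.2.2]⟩ hX
  have e0 : y 0 = a * q 0 + b * p 0 + c * r 0 := by rw [h]; simp
  have e1 : y 1 = a * q 1 + b * p 1 + c * r 1 := by rw [h]; simp
  set M := α * y 0 + β * y 1 with hM
  have e : a * ((α * q 0 + β * q 1) - M) + b * ((α * p 0 + β * p 1) - M) +
      c * ((α * r 0 + β * r 1) - M) = 0 := by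
    have : a * M + b * M + c * M = M := by rw [← add_mul, ← add_mul, hs, one_mul]
    have e2 : M = α * (a * q 0 + b * p 0 + c * r 0) + β * (a * q 1 + b * p 1 + c * r 1) := by
      rw [hM, ← e0, ← e1]
    linear_combination -e2 - this
  have p1 := mul_nonneg ha (sub_nonneg.2 f2)
  have p2 := mul_nonneg hb (sub_nonneg.2 f1)
  have p3 := mul_nonneg hc (sub_nonneg.2 f3.le)
  have z3 : c = 0 := by
    rcases mul_eq_zero.1 (show c * ((α * r 0 + β * r 1) - M) = 0 by linarith) with h | h
    · exact h
    · linarith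
  subst z3
  exact ⟨b, a, hb, ha, by linarith, by rw [h]; module⟩


/-- The seven triangles around one end of the arm. -/
def half (k : ℝ) : Set Plane :=
  tri (ve k) (va k) (vb k) ∪ tri (ve k) (vb k) (vc k)
    ∪ tri (ve k) (vc k) (vd k) ∪ tri (vc k) (vb k) (s1 k)
    ∪ tri (vd k) (vc k) (s2 k) ∪ tri (ve k) (vd k) (s3 k)
    ∪ tri (va k) (ve k) (s4 k)

theorem pos_cr (k : ℝ) (hk : 10 ≤ k) :
    0 < cr (ve k) (va k) (vb k) ∧
    0 < cr (ve k) (vb k) (vc k) ∧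
    0 < cr (ve k) (vc k) (vd k) ∧
    0 < cr (vc k) (vb k) (s1 k) ∧
    0 < cr (vd k) (vc k) (s2 k) ∧
    0 < cr (ve k) (vd k) (s3 k) ∧
    0 < cr (va k) (ve k) (s4 k) ∧
    0 < cr (vb k) (va k) (-(va k)) := by
  refine ⟨?_, ?_, ?_, ?_, ?_, ?_, ?_, ?_⟩ <;> (simp only [cr, coords, PiLp.neg_apply]; nlinarith)

theorem sep_2 (k : ℝ) (hk : 10 ≤ k) {y : Plane} (hB : y ∈ tri (ve k) (vb k) (vc k))
    (hA : y ∈ tri (ve k) (va k) (vb k)) :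
    y ∈ segment ℝ (vb k) (ve k) := by
  have h := hA
  · refine sep (2) (3) h hB ⟨?_, ?_, ?_⟩ ⟨?_, ?_, ?_⟩ ⟨?_, ?_, ?_⟩ <;>
      (simp only [coords, PiLp.neg_apply]; linarith)

theorem sep_3 (k : ℝ) (hk : 10 ≤ k) {y : Plane} (hB : y ∈ tri (ve k) (vc k) (vd k))
    (hA : y ∈ tri (ve k) (va k) (vb k) ∨ y ∈ tri (ve k) (vb k) (vc k)) :
    y ∈ segment ℝ (vc k) (ve k) := by
  rcases hA with h | h
  · refine sep (0) (1) h hB ⟨?_, ?_, ?_⟩ ⟨?_, ?_, ?_⟩ ⟨?_, ?_, ?_⟩ <;>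
      (simp only [coords, PiLp.neg_apply]; linarith)
  · refine sep (0) (1) h hB ⟨?_, ?_, ?_⟩ ⟨?_, ?_, ?_⟩ ⟨?_, ?_, ?_⟩ <;>
      (simp only [coords, PiLp.neg_apply]; linarith)

theorem sep_4 (k : ℝ) (hk : 10 ≤ k) {y : Plane} (hB : y ∈ tri (vc k) (vb k) (s1 k))
    (hA : y ∈ tri (ve k) (va k) (vb k) ∨ y ∈ tri (ve k) (vb k) (vc k) ∨ y ∈ tri (ve k) (vc k) (vd k)) :
    y ∈ segment ℝ (vb k) (vc k) := by
  rcases hA with h | h | h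
  · refine sep (1) (1) h hB ⟨?_, ?_, ?_⟩ ⟨?_, ?_, ?_⟩ ⟨?_, ?_, ?_⟩ <;>
      (simp only [coords, PiLp.neg_apply]; linarith)
  · refine sep (4) (1) h hB ⟨?_, ?_, ?_⟩ ⟨?_, ?_, ?_⟩ ⟨?_, ?_, ?_⟩ <;>
      (simp only [coords, PiLp.neg_apply]; linarith)
  · refine sep (1) (0) h hB ⟨?_, ?_, ?_⟩ ⟨?_, ?_, ?_⟩ ⟨?_, ?_, ?_⟩ <;>
      (simp only [coords, PiLp.neg_apply]; linarith)

theorem sep_5 (k : ℝ) (hk : 10 ≤ k) {y : Plane} (hB : y ∈ tri (vd k) (vc k) (s2 k))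
    (hA : y ∈ tri (ve k) (va k) (vb k) ∨ y ∈ tri (ve k) (vb k) (vc k) ∨ y ∈ tri (ve k) (vc k) (vd k) ∨ y ∈ tri (vc k) (vb k) (s1 k)) :
    y ∈ segment ℝ (vc k) (vd k) := by
  rcases hA with h | h | h | h
  · refine sep (0) (1) h hB ⟨?_, ?_, ?_⟩ ⟨?_, ?_, ?_⟩ ⟨?_, ?_, ?_⟩ <;>
      (simp only [coords, PiLp.neg_apply]; linarith)
  · refine sep (0) (1) h hB ⟨?_, ?_, ?_⟩ ⟨?_, ?_, ?_⟩ ⟨?_, ?_, ?_⟩ <;>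
      (simp only [coords, PiLp.neg_apply]; linarith)
  · refine sep (1) (0) h hB ⟨?_, ?_, ?_⟩ ⟨?_, ?_, ?_⟩ ⟨?_, ?_, ?_⟩ <;>
      (simp only [coords, PiLp.neg_apply]; linarith)
  · refine sep (-3) (1) h hB ⟨?_, ?_, ?_⟩ ⟨?_, ?_, ?_⟩ ⟨?_, ?_, ?_⟩ <;>
      (simp only [coords, PiLp.neg_apply]; linarith)

theorem sep_6 (k : ℝ) (hk : 10 ≤ k) {y : Plane} (hB : y ∈ tri (ve k) (vd k) (s3 k))
    (hA : y ∈ tri (ve k) (va k) (vb k) ∨ y ∈ tri (ve k) (vb k) (vc k) ∨ y ∈ tri (ve k) (vc k) (vd k) ∨ y ∈ tri (vc k) (vb k) (s1 k) ∨ y ∈ tri (vd k) (vc k) (s2 k)) :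
    y ∈ segment ℝ (vd k) (ve k) := by
  rcases hA with h | h | h | h | h
  · refine sep (-4) (5) h hB ⟨?_, ?_, ?_⟩ ⟨?_, ?_, ?_⟩ ⟨?_, ?_, ?_⟩ <;>
      (simp only [coords, PiLp.neg_apply]; linarith)
  · refine sep (-4) (5) h hB ⟨?_, ?_, ?_⟩ ⟨?_, ?_, ?_⟩ ⟨?_, ?_, ?_⟩ <;>
      (simp only [coords, PiLp.neg_apply]; linarith)
  · refine sep (-4) (5) h hB ⟨?_, ?_, ?_⟩ ⟨?_, ?_, ?_⟩ ⟨?_, ?_, ?_⟩ <;>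
      (simp only [coords, PiLp.neg_apply]; linarith)
  · refine sep (-1) (0) h hB ⟨?_, ?_, ?_⟩ ⟨?_, ?_, ?_⟩ ⟨?_, ?_, ?_⟩ <;>
      (simp only [coords, PiLp.neg_apply]; linarith)
  · refine sep (-1) (0) h hB ⟨?_, ?_, ?_⟩ ⟨?_, ?_, ?_⟩ ⟨?_, ?_, ?_⟩ <;>
      (simp only [coords, PiLp.neg_apply]; linarith)

theorem sep_7 (k : ℝ) (hk : 10 ≤ k) {y : Plane} (hB : y ∈ tri (va k) (ve k) (s4 k))
    (hA : y ∈ tri (ve k) (va k) (vb k) ∨ y ∈ tri (ve k) (vb k) (vc k) ∨ y ∈ tri (ve k) (vc k) (vd k) ∨ y ∈ tri (vc k) (vb k) (s1 k) ∨ y ∈ tri (vd k) (vc k) (s2 k) ∨ y ∈ tri (ve k) (vd k) (s3 k)) :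
    y ∈ segment ℝ (ve k) (va k) := by
  rcases hA with h | h | h | h | h | h
  · refine sep (-5) (-7) h hB ⟨?_, ?_, ?_⟩ ⟨?_, ?_, ?_⟩ ⟨?_, ?_, ?_⟩ <;>
      (simp only [coords, PiLp.neg_apply]; linarith)
  · refine sep (-2) (-3) h hB ⟨?_, ?_, ?_⟩ ⟨?_, ?_, ?_⟩ ⟨?_, ?_, ?_⟩ <;>
      (simp only [coords, PiLp.neg_apply]; linarith)
  · refine sep (0) (-1) h hB ⟨?_, ?_, ?_⟩ ⟨?_, ?_, ?_⟩ ⟨?_, ?_, ?_⟩ <;>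
      (simp only [coords, PiLp.neg_apply]; linarith)
  · refine sep (-1) (-1) h hB ⟨?_, ?_, ?_⟩ ⟨?_, ?_, ?_⟩ ⟨?_, ?_, ?_⟩ <;>
      (simp only [coords, PiLp.neg_apply]; linarith)
  · refine sep (0) (-1) h hB ⟨?_, ?_, ?_⟩ ⟨?_, ?_, ?_⟩ ⟨?_, ?_, ?_⟩ <;>
      (simp only [coords, PiLp.neg_apply]; linarith)
  · refine sep (3) (-4) h hB ⟨?_, ?_, ?_⟩ ⟨?_, ?_, ?_⟩ ⟨?_, ?_, ?_⟩ <;>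
      (simp only [coords, PiLp.neg_apply]; linarith)

theorem sep_8 (k : ℝ) (hk : 10 ≤ k) {y : Plane} (hB : y ∈ tri (vb k) (va k) (-(va k)))
    (hA : y ∈ tri (ve k) (va k) (vb k) ∨ y ∈ tri (ve k) (vb k) (vc k) ∨ y ∈ tri (ve k) (vc k) (vd k) ∨ y ∈ tri (vc k) (vb k) (s1 k) ∨ y ∈ tri (vd k) (vc k) (s2 k) ∨ y ∈ tri (ve k) (vd k) (s3 k) ∨ y ∈ tri (va k) (ve k) (s4 k)) :
    y ∈ segment ℝ (va k) (vb k) := by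
  rcases hA with h | h | h | h | h | h | h
  · refine sep (1) (1) h hB ⟨?_, ?_, ?_⟩ ⟨?_, ?_, ?_⟩ ⟨?_, ?_, ?_⟩ <;>
      (simp only [coords, PiLp.neg_apply]; linarith)
  · refine sep (1) (0) h hB ⟨?_, ?_, ?_⟩ ⟨?_, ?_, ?_⟩ ⟨?_, ?_, ?_⟩ <;>
      (simp only [coords, PiLp.neg_apply]; linarith)
  · refine sep (1) (0) h hB ⟨?_, ?_, ?_⟩ ⟨?_, ?_, ?_⟩ ⟨?_, ?_, ?_⟩ <;>
      (simp only [coords, PiLp.neg_apply]; linarith)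
  · refine sep (1) (-1) h hB ⟨?_, ?_, ?_⟩ ⟨?_, ?_, ?_⟩ ⟨?_, ?_, ?_⟩ <;>
      (simp only [coords, PiLp.neg_apply]; linarith)
  · refine sep (1) (-1) h hB ⟨?_, ?_, ?_⟩ ⟨?_, ?_, ?_⟩ ⟨?_, ?_, ?_⟩ <;>
      (simp only [coords, PiLp.neg_apply]; linarith)
  · refine sep (1) (0) h hB ⟨?_, ?_, ?_⟩ ⟨?_, ?_, ?_⟩ ⟨?_, ?_, ?_⟩ <;>
      (simp only [coords, PiLp.neg_apply]; linarith)
  · refine sep (1) (1) h hB ⟨?_, ?_, ?_⟩ ⟨?_, ?_, ?_⟩ ⟨?_, ?_, ?_⟩ <;>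
      (simp only [coords, PiLp.neg_apply]; linarith)

theorem sep_9 (k : ℝ) (hk : 10 ≤ k) {y : Plane} (hB : y ∈ tri (va k) (-(va k)) (-(vb k)))
    (hA : y ∈ tri (ve k) (va k) (vb k) ∨ y ∈ tri (ve k) (vb k) (vc k) ∨ y ∈ tri (ve k) (vc k) (vd k) ∨ y ∈ tri (vc k) (vb k) (s1 k) ∨ y ∈ tri (vd k) (vc k) (s2 k) ∨ y ∈ tri (ve k) (vd k) (s3 k) ∨ y ∈ tri (va k) (ve k) (s4 k) ∨ y ∈ tri (vb k) (va k) (-(va k))) :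
    y ∈ segment ℝ (-(va k)) (va k) := by
  rcases hA with h | h | h | h | h | h | h | h
  · refine sep (1) (0) h hB ⟨?_, ?_, ?_⟩ ⟨?_, ?_, ?_⟩ ⟨?_, ?_, ?_⟩ <;>
      (simp only [coords, PiLp.neg_apply]; linarith)
  · refine sep (1) (0) h hB ⟨?_, ?_, ?_⟩ ⟨?_, ?_, ?_⟩ ⟨?_, ?_, ?_⟩ <;>
      (simp only [coords, PiLp.neg_apply]; linarith)
  · refine sep (1) (0) h hB ⟨?_, ?_, ?_⟩ ⟨?_, ?_, ?_⟩ ⟨?_, ?_, ?_⟩ <;>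
      (simp only [coords, PiLp.neg_apply]; linarith)
  · refine sep (1) (-1) h hB ⟨?_, ?_, ?_⟩ ⟨?_, ?_, ?_⟩ ⟨?_, ?_, ?_⟩ <;>
      (simp only [coords, PiLp.neg_apply]; linarith)
  · refine sep (1) (-1) h hB ⟨?_, ?_, ?_⟩ ⟨?_, ?_, ?_⟩ ⟨?_, ?_, ?_⟩ <;>
      (simp only [coords, PiLp.neg_apply]; linarith)
  · refine sep (1) (0) h hB ⟨?_, ?_, ?_⟩ ⟨?_, ?_, ?_⟩ ⟨?_, ?_, ?_⟩ <;>
      (simp only [coords, PiLp.neg_apply]; linarith)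
  · refine sep (1) (1) h hB ⟨?_, ?_, ?_⟩ ⟨?_, ?_, ?_⟩ ⟨?_, ?_, ?_⟩ <;>
      (simp only [coords, PiLp.neg_apply]; linarith)
  · refine sep 10 (4 - 325 * k) h hB ⟨?_, ?_, ?_⟩ ⟨?_, ?_, ?_⟩ ⟨?_, ?_, ?_⟩ <;>
      (simp only [coords, PiLp.neg_apply]; nlinarith)

/-- Seven triangles plus half of the arm. -/
def plus (k : ℝ) : Set Plane := half k ∪ tri (vb k) (va k) (-(va k))

/-- The whole (unscaled) polygon. -/
def body (k : ℝ) : Set Plane := plus k ∪ (fun x => (-1 : ℝ) • x) '' plus k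

theorem PR_plus (k : ℝ) (hk : 10 ≤ k) : PR (plus k)
    [(va k, -(va k)), (-(va k), vb k), (vb k, s1 k), (s1 k, vc k), (vc k, s2 k), (s2 k, vd k),
      (vd k, s3 k), (s3 k, ve k), (ve k, s4 k), (s4 k, va k)] := by
  obtain ⟨c1, c2, c3, c4, c5, c6, c7, c8⟩ := pos_cr k hk
  have g1 := PR_tri c1
  have g2 := glueTri g1.rot.rot c2 (fun y hy => sep_2 k hk hy.2 hy.1)
  have g3 := glueTri g2.rot.rot.rot c3 (fun y hy => sep_3 k hk hy.2 hy.1)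
  have g4 := glueTri g3.rot.rot c4 (fun y hy => sep_4 k hk hy.2 (by
    have := hy.1; simp only [mem_union] at this; tauto))
  have g5 := glueTri g4 c5 (fun y hy => sep_5 k hk hy.2 (by
    have := hy.1; simp only [mem_union] at this; tauto))
  have g6 := glueTri g5 c6 (fun y hy => sep_6 k hk hy.2 (by
    have := hy.1; simp only [mem_union] at this; tauto))
  have g7 := glueTri g6 c7 (fun y hy => sep_7 k hk hy.2 (by
    have := hy.1; simp only [mem_union] at this; tauto))
  have g8 := glueTri g7 c8 (fun y hy => sep_8 k hk hy.2 (by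
    have := hy.1; simp only [mem_union] at this; tauto))
  exact g8.rot.rot.rot.rot.rot.rot.rot.rot

theorem neg_tri {p q r x : Plane} : -x ∈ tri p q r ↔ x ∈ tri (-p) (-q) (-r) := by
  simp only [mem_tri]
  constructor
  · rintro ⟨a, b, c, ha, hb, hc, h, hx⟩
    exact ⟨a, b, c, ha, hb, hc, h, by rw [← neg_neg x, hx]; module⟩
  · rintro ⟨a, b, c, ha, hb, hc, h, hx⟩
    exact ⟨a, b, c, ha, hb, hc, h, by rw [hx]; module⟩

theorem tri_swap {p q r x : Plane} : x ∈ tri p q r ↔ x ∈ tri q p r := by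
  unfold tri; rw [insert_comm]

theorem mem_body {k : ℝ} {x : Plane} : x ∈ body k ↔ x ∈ plus k ∨ -x ∈ plus k := by
  unfold body
  constructor
  · rintro (h | ⟨y, hy, rfl⟩)
    · exact Or.inl h
    · right; simpa using hy
  · rintro (h | h)
    · exact Or.inl h
    · exact Or.inr ⟨-x, h, by simp⟩

theorem half_neg {k : ℝ} (hk : 10 ≤ k) {x : Plane} (h : x ∈ half k) : x 0 < 0 := by
  by_contra hcon
  simp only [half, mem_union] at h
  rcases h with (((((h | h) | h) | h) | h) | h) | h <;>
  · refine not_tri 1 0 ?_ h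
    refine ⟨?_, ?_, ?_⟩ <;> (simp only [coords]; linarith)

theorem half_or {k : ℝ} {x : Plane} (h : x ∈ half k) : x ∈ tri (ve k) (va k) (vb k) ∨
    x ∈ tri (ve k) (vb k) (vc k) ∨ x ∈ tri (ve k) (vc k) (vd k) ∨ x ∈ tri (vc k) (vb k) (s1 k) ∨
    x ∈ tri (vd k) (vc k) (s2 k) ∨ x ∈ tri (ve k) (vd k) (s3 k) ∨ x ∈ tri (va k) (ve k) (s4 k) := by
  simp only [half, mem_union] at h; tauto

theorem plus_meet {k : ℝ} (hk : 10 ≤ k) {x : Plane} (h1 : x ∈ plus k) (h2 : -x ∈ plus k) :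
    x ∈ segment ℝ (va k) (-(va k)) := by
  have flip : ∀ {y : Plane}, -y ∈ tri (vb k) (va k) (-(va k)) →
      y ∈ tri (va k) (-(va k)) (-(vb k)) := by
    intro y hy
    rw [neg_tri, neg_neg] at hy
    unfold tri at hy ⊢
    rwa [show ({va k, -va k, -vb k} : Set Plane) = {-vb k, -va k, va k} by
      ext z; simp only [mem_insert_iff, mem_singleton_iff]; tauto]
  have key : ∀ {y : Plane}, y ∈ plus k → -y ∈ tri (vb k) (va k) (-(va k)) →
      y ∈ segment ℝ (-(va k)) (va k) := by
    intro y hy hy'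
    refine sep_9 k hk (flip hy') ?_
    rcases hy with hy | hy
    · have := half_or hy; tauto
    · tauto
  rcases h2 with h2 | h2
  · rcases h1 with h1 | h1
    · have := half_neg hk h1
      have := half_neg hk h2
      simp only [PiLp.neg_apply] at this
      linarith
    · have := key (Or.inl h2) (by rwa [neg_neg])
      obtain ⟨s, t, hs, ht, hst, he⟩ := this
      exact ⟨s, t, hs, ht, hst, by rw [← neg_neg x, ← he]; module⟩
  · rw [segment_symm]; exact key h1 h2

theorem PR_body (k : ℝ) (hk : 10 ≤ k) : PR (body k)
    [(-(va k), vb k), (vb k, s1 k), (s1 k, vc k), (vc k, s2 k), (s2 k, vd k),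
      (vd k, s3 k), (s3 k, ve k), (ve k, s4 k), (s4 k, va k),
      (va k, -(vb k)), (-(vb k), -(s1 k)), (-(s1 k), -(vc k)), (-(vc k), -(s2 k)),
      (-(s2 k), -(vd k)), (-(vd k), -(s3 k)), (-(s3 k), -(ve k)), (-(ve k), -(s4 k)),
      (-(s4 k), -(va k))] := by
  have g := PR_plus k hk
  have g2 := g.smul (c := -1) (by norm_num)
  simp only [List.map_cons, List.map_nil, neg_smul, one_smul, neg_neg] at g2
  have g3 := glue g g2.swap ?_ ?_ ?_
  · have hb : body k = plus k ∪ (fun x => -x) '' plus k := by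
      simp only [body, neg_smul, one_smul]
    rw [hb]
    exact g3
  · rintro x ⟨h1, ⟨y, hy, rfl⟩⟩
    exact plus_meet hk h1 (by rwa [neg_neg])
  · exact ⟨(s4 k, va k), by simp, right_mem_segment _ _ _⟩
  · exact ⟨(-(va k), vb k), by simp, left_mem_segment _ _ _⟩


theorem not_body {k : ℝ} (hk : 10 ≤ k) {z : Plane} (h0 : z 0 < 0)
    (n1 : z ∉ tri (ve k) (va k) (vb k)) (n2 : z ∉ tri (ve k) (vb k) (vc k))
    (n3 : z ∉ tri (ve k) (vc k) (vd k)) (n4 : z ∉ tri (vc k) (vb k) (s1 k))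
    (n5 : z ∉ tri (vd k) (vc k) (s2 k)) (n6 : z ∉ tri (ve k) (vd k) (s3 k))
    (n7 : z ∉ tri (va k) (ve k) (s4 k)) (n8 : z ∉ tri (vb k) (va k) (-(va k)))
    (n9 : z ∉ tri (-(vb k)) (-(va k)) (va k)) : z ∉ body k := by
  rw [mem_body]
  rintro ((h | h) | (h | h))
  · have := half_or h; tauto
  · exact n8 h
  · have := half_neg hk h
    simp only [PiLp.neg_apply] at this
    linarith
  · rw [neg_tri, neg_neg] at h
    exact n9 h

theorem no_see {A : Set Plane} {p q : Plane} (t : ℝ) (ht0 : 0 ≤ t) (ht1 : t ≤ 1)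
    (h : ∀ z : Plane, z 0 = (1 - t) * p 0 + t * q 0 → z 1 = (1 - t) * p 1 + t * q 1 → z ∉ A) :
    ¬ Sees A p q := by
  intro hs
  refine h ((1 - t) • p + t • q) (by simp) (by simp) (hs ⟨1 - t, t, by linarith, ht0, by ring, rfl⟩)

theorem ns_va_w (k : ℝ) (hk : 10 ≤ k) : ¬ Sees (body k) (va k) (vw k) := by
  refine no_see (7 / 40) (by norm_num) (by norm_num) fun z h0 h1 => ?_
  simp only [coords, PiLp.zero_apply] at h0 h1
  refine not_body hk ?_ (not_tri (1) (1) ⟨?_, ?_, ?_⟩) (not_tri (1) (0) ⟨?_, ?_, ?_⟩)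
     (not_tri (0) (-1) ⟨?_, ?_, ?_⟩) (not_tri (1) (-1) ⟨?_, ?_, ?_⟩) (not_tri (0) (-1) ⟨?_, ?_, ?_⟩)
     (not_tri (1) (0) ⟨?_, ?_, ?_⟩) (not_tri (1) (1) ⟨?_, ?_, ?_⟩) (not_tri (-1) (2) ⟨?_, ?_, ?_⟩)
     (not_tri (-1) (0) ⟨?_, ?_, ?_⟩) <;>
  · simp only [coords, PiLp.neg_apply, h0, h1]; linarith

theorem ns_vb_w (k : ℝ) (hk : 10 ≤ k) : ¬ Sees (body k) (vb k) (vw k) := by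
  refine no_see (14 / 23) (by norm_num) (by norm_num) fun z h0 h1 => ?_
  simp only [coords, PiLp.zero_apply] at h0 h1
  refine not_body hk ?_ (not_tri (0) (1) ⟨?_, ?_, ?_⟩) (not_tri (0) (1) ⟨?_, ?_, ?_⟩)
     (not_tri (1) (0) ⟨?_, ?_, ?_⟩) (not_tri (-5) (2) ⟨?_, ?_, ?_⟩) (not_tri (10) (-3) ⟨?_, ?_, ?_⟩)
     (not_tri (1) (0) ⟨?_, ?_, ?_⟩) (not_tri (0) (1) ⟨?_, ?_, ?_⟩) (not_tri (-1) (0) ⟨?_, ?_, ?_⟩)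
     (not_tri (-1) (0) ⟨?_, ?_, ?_⟩) <;>
  · simp only [coords, PiLp.neg_apply, h0, h1]; linarith

theorem ns_s1_w (k : ℝ) (hk : 10 ≤ k) : ¬ Sees (body k) (s1 k) (vw k) := by
  refine no_see (1 / 2) (by norm_num) (by norm_num) fun z h0 h1 => ?_
  simp only [coords, PiLp.zero_apply] at h0 h1
  refine not_body hk ?_ (not_tri (0) (1) ⟨?_, ?_, ?_⟩) (not_tri (0) (1) ⟨?_, ?_, ?_⟩)
     (not_tri (0) (1) ⟨?_, ?_, ?_⟩) (not_tri (-12) (5) ⟨?_, ?_, ?_⟩) (not_tri (3) (-1) ⟨?_, ?_, ?_⟩)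
     (not_tri (0) (1) ⟨?_, ?_, ?_⟩) (not_tri (0) (1) ⟨?_, ?_, ?_⟩) (not_tri (0) (1) ⟨?_, ?_, ?_⟩)
     (not_tri (0) (1) ⟨?_, ?_, ?_⟩) <;>
  · simp only [coords, PiLp.neg_apply, h0, h1]; linarith

theorem ns_s1_O (k : ℝ) (hk : 10 ≤ k) : ¬ Sees (body k) (s1 k) 0 := by
  refine no_see (1 / 2) (by norm_num) (by norm_num) fun z h0 h1 => ?_
  simp only [coords, PiLp.zero_apply] at h0 h1
  refine not_body hk ?_ (not_tri (0) (1) ⟨?_, ?_, ?_⟩) (not_tri (0) (1) ⟨?_, ?_, ?_⟩)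
     (not_tri (0) (1) ⟨?_, ?_, ?_⟩) (not_tri (1) (0) ⟨?_, ?_, ?_⟩) (not_tri (1) (0) ⟨?_, ?_, ?_⟩)
     (not_tri (0) (1) ⟨?_, ?_, ?_⟩) (not_tri (0) (1) ⟨?_, ?_, ?_⟩) (not_tri (0) (1) ⟨?_, ?_, ?_⟩)
     (not_tri (0) (1) ⟨?_, ?_, ?_⟩) <;>
  · simp only [coords, PiLp.neg_apply, h0, h1]; linarith

theorem ns_s2_w (k : ℝ) (hk : 10 ≤ k) : ¬ Sees (body k) (s2 k) (vw k) := by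
  refine no_see (1 / 2) (by norm_num) (by norm_num) fun z h0 h1 => ?_
  simp only [coords, PiLp.zero_apply] at h0 h1
  refine not_body hk ?_ (not_tri (0) (1) ⟨?_, ?_, ?_⟩) (not_tri (0) (1) ⟨?_, ?_, ?_⟩)
     (not_tri (0) (1) ⟨?_, ?_, ?_⟩) (not_tri (-2) (1) ⟨?_, ?_, ?_⟩) (not_tri (-24) (7) ⟨?_, ?_, ?_⟩)
     (not_tri (0) (1) ⟨?_, ?_, ?_⟩) (not_tri (0) (1) ⟨?_, ?_, ?_⟩) (not_tri (0) (1) ⟨?_, ?_, ?_⟩)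
     (not_tri (0) (1) ⟨?_, ?_, ?_⟩) <;>
  · simp only [coords, PiLp.neg_apply, h0, h1]; linarith

theorem ns_s2_O (k : ℝ) (hk : 10 ≤ k) : ¬ Sees (body k) (s2 k) 0 := by
  refine no_see (1 / 2) (by norm_num) (by norm_num) fun z h0 h1 => ?_
  simp only [coords, PiLp.zero_apply] at h0 h1
  refine not_body hk ?_ (not_tri (0) (1) ⟨?_, ?_, ?_⟩) (not_tri (0) (1) ⟨?_, ?_, ?_⟩)
     (not_tri (0) (1) ⟨?_, ?_, ?_⟩) (not_tri (1) (0) ⟨?_, ?_, ?_⟩) (not_tri (1) (0) ⟨?_, ?_, ?_⟩)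
     (not_tri (0) (1) ⟨?_, ?_, ?_⟩) (not_tri (0) (1) ⟨?_, ?_, ?_⟩) (not_tri (0) (1) ⟨?_, ?_, ?_⟩)
     (not_tri (0) (1) ⟨?_, ?_, ?_⟩) <;>
  · simp only [coords, PiLp.neg_apply, h0, h1]; linarith

theorem ns_s3_w (k : ℝ) (hk : 10 ≤ k) : ¬ Sees (body k) (s3 k) (vw k) := by
  refine no_see (1 / 2) (by norm_num) (by norm_num) fun z h0 h1 => ?_
  simp only [coords, PiLp.zero_apply] at h0 h1
  refine not_body hk ?_ (not_tri (-1) (0) ⟨?_, ?_, ?_⟩) (not_tri (-1) (0) ⟨?_, ?_, ?_⟩)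
     (not_tri (-1) (0) ⟨?_, ?_, ?_⟩) (not_tri (-1) (0) ⟨?_, ?_, ?_⟩) (not_tri (-1) (0) ⟨?_, ?_, ?_⟩)
     (not_tri (3) (-4) ⟨?_, ?_, ?_⟩) (not_tri (-1) (0) ⟨?_, ?_, ?_⟩) (not_tri (-1) (0) ⟨?_, ?_, ?_⟩)
     (not_tri (-1) (0) ⟨?_, ?_, ?_⟩) <;>
  · simp only [coords, PiLp.neg_apply, h0, h1]; linarith

theorem ns_s3_O (k : ℝ) (hk : 10 ≤ k) : ¬ Sees (body k) (s3 k) 0 := by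
  refine no_see (1 / 2) (by norm_num) (by norm_num) fun z h0 h1 => ?_
  simp only [coords, PiLp.zero_apply] at h0 h1
  refine not_body hk ?_ (not_tri (-1) (0) ⟨?_, ?_, ?_⟩) (not_tri (-1) (0) ⟨?_, ?_, ?_⟩)
     (not_tri (-1) (0) ⟨?_, ?_, ?_⟩) (not_tri (-1) (0) ⟨?_, ?_, ?_⟩) (not_tri (-1) (0) ⟨?_, ?_, ?_⟩)
     (not_tri (1) (-1) ⟨?_, ?_, ?_⟩) (not_tri (-1) (0) ⟨?_, ?_, ?_⟩) (not_tri (-1) (0) ⟨?_, ?_, ?_⟩)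
     (not_tri (-1) (0) ⟨?_, ?_, ?_⟩) <;>
  · simp only [coords, PiLp.neg_apply, h0, h1]; linarith

theorem ns_s4_w (k : ℝ) (hk : 10 ≤ k) : ¬ Sees (body k) (s4 k) (vw k) := by
  refine no_see (1 / 2) (by norm_num) (by norm_num) fun z h0 h1 => ?_
  simp only [coords, PiLp.zero_apply] at h0 h1
  refine not_body hk ?_ (not_tri (0) (-1) ⟨?_, ?_, ?_⟩) (not_tri (0) (-1) ⟨?_, ?_, ?_⟩)
     (not_tri (0) (-1) ⟨?_, ?_, ?_⟩) (not_tri (0) (-1) ⟨?_, ?_, ?_⟩) (not_tri (0) (-1) ⟨?_, ?_, ?_⟩)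
     (not_tri (1) (0) ⟨?_, ?_, ?_⟩) (not_tri (12) (5) ⟨?_, ?_, ?_⟩) (not_tri (0) (-1) ⟨?_, ?_, ?_⟩)
     (not_tri (0) (-1) ⟨?_, ?_, ?_⟩) <;>
  · simp only [coords, PiLp.neg_apply, h0, h1]; linarith

theorem ns_s4_O (k : ℝ) (hk : 10 ≤ k) : ¬ Sees (body k) (s4 k) 0 := by
  refine no_see (1 / 2) (by norm_num) (by norm_num) fun z h0 h1 => ?_
  simp only [coords, PiLp.zero_apply] at h0 h1
  refine not_body hk ?_ (not_tri (0) (-1) ⟨?_, ?_, ?_⟩) (not_tri (0) (-1) ⟨?_, ?_, ?_⟩)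
     (not_tri (0) (-1) ⟨?_, ?_, ?_⟩) (not_tri (0) (-1) ⟨?_, ?_, ?_⟩) (not_tri (0) (-1) ⟨?_, ?_, ?_⟩)
     (not_tri (1) (0) ⟨?_, ?_, ?_⟩) (not_tri (1) (0) ⟨?_, ?_, ?_⟩) (not_tri (0) (-1) ⟨?_, ?_, ?_⟩)
     (not_tri (0) (-1) ⟨?_, ?_, ?_⟩) <;>
  · simp only [coords, PiLp.neg_apply, h0, h1]; linarith

theorem ext_line (k : ℝ) (hk : 10 ≤ k) (z : Plane) (h0 : z 0 = -325 * k + 10) (h1 : -1 ≤ z 1)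
    (h2 : z 1 ≤ 9) : z ∉ body k := by
  refine not_body hk ?_ (not_tri (1) (0) ⟨?_, ?_, ?_⟩) (not_tri (1) (0) ⟨?_, ?_, ?_⟩)
     (not_tri (1) (0) ⟨?_, ?_, ?_⟩) (not_tri (7) (-3) ⟨?_, ?_, ?_⟩) (not_tri (3) (-1) ⟨?_, ?_, ?_⟩)
     (not_tri (1) (0) ⟨?_, ?_, ?_⟩) (not_tri (1) (1) ⟨?_, ?_, ?_⟩) (not_tri (-1) (2) ⟨?_, ?_, ?_⟩)
     (not_tri (-1) (2) ⟨?_, ?_, ?_⟩) <;>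
  · simp only [coords, PiLp.neg_apply, h0]; linarith

/-- Points near the left end (above the arm's mouth) see nothing in the right half plane. -/
theorem far_axis (k : ℝ) (hk : 10 ≤ k) {p q : Plane} (hp0 : p 0 ≤ -325 * k)
    (hp0' : -325 * k - 10 ≤ p 0) (hp1 : 0 ≤ p 1) (hp1' : p 1 ≤ 8) (hq : q 0 = 0) (hq1 : -10 ≤ q 1)
    (hq2 : q 1 ≤ 10) : ¬ Sees (body k) p q := by
  have hneg : 0 < -p 0 := by linarith
  set t : ℝ := (-325 * k + 10 - p 0) / (-p 0) with ht
  have ht0 : 0 ≤ t := div_nonneg (by linarith) hneg.le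
  have htl : t ≤ 1 / 50 := by
    rw [ht, div_le_div_iff₀ hneg (by norm_num)]; linarith
  have hmul : t * (-p 0) = -325 * k + 10 - p 0 := div_mul_cancel₀ _ hneg.ne'
  refine no_see t ht0 (by linarith) fun z h0 h1 => ?_
  refine ext_line k hk z ?_ ?_ ?_
  · rw [h0, hq]; linarith
  · rw [h1]; nlinarith
  · rw [h1]; nlinarith

theorem axis_body (k : ℝ) (hk : 10 ≤ k) {m : Plane} (h : m ∈ body k) (h0 : m 0 = 0) :
    -10 ≤ m 1 ∧ m 1 ≤ 10 := by
  have key : ∀ y : Plane, y 0 = 0 → y ∈ plus k → -10 ≤ y 1 ∧ y 1 ≤ 10 := by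
    rintro y hy0 (hy | hy)
    · have := half_neg hk hy; linarith
    · have a1 := fun_tri (α := 0) (β := 1) (M := 10) hy rfl rfl
        (by simp only [coords]; norm_num) (by simp only [coords]; norm_num)
        (by simp only [coords, PiLp.neg_apply]; norm_num)
      have a2 := fun_tri (α := 0) (β := -1) (M := 10) hy rfl rfl
        (by simp only [coords]; norm_num) (by simp only [coords]; norm_num)
        (by simp only [coords, PiLp.neg_apply]; norm_num)
      constructor <;> linarith
  rcases mem_body.1 h with h | h
  · exact key m h0 h
  · have := key (-m) (by simp [h0]) h
    simp only [PiLp.neg_apply] at this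
    constructor <;> linarith [this.1, this.2]

theorem far (k : ℝ) (hk : 10 ≤ k) {p q : Plane} (hp0 : p 0 ≤ -325 * k)
    (hp0' : -325 * k - 10 ≤ p 0) (hp1 : 0 ≤ p 1) (hp1' : p 1 ≤ 8) (hq : 0 ≤ q 0) :
    ¬ Sees (body k) p q := by
  intro hs
  have hneg : 0 < -p 0 := by linarith
  have hd : 0 < q 0 - p 0 := by linarith
  obtain ⟨t, hmul⟩ : ∃ t : ℝ, t * (q 0 - p 0) = -p 0 := ⟨_, div_mul_cancel₀ _ hd.ne'⟩
  have ht0 : 0 ≤ t := by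
    by_contra hcon
    nlinarith [mul_pos (neg_pos.2 (not_le.1 hcon)) hd]
  have ht1 : t ≤ 1 := by
    by_contra hcon
    nlinarith [mul_pos (sub_pos.2 (not_le.1 hcon)) hd]
  obtain ⟨m, hm, hm0⟩ : ∃ m ∈ segment ℝ p q, m 0 = 0 := by
    refine ⟨(1 - t) • p + t • q, ⟨1 - t, t, by linarith, ht0, by ring, rfl⟩, ?_⟩
    simp only [PiLp.add_apply, PiLp.smul_apply, smul_eq_mul]; linarith
  have hb := axis_body k hk (hs hm) hm0
  have hsub : segment ℝ p m ⊆ segment ℝ p q :=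
    (convex_segment p q).segment_subset (left_mem_segment _ _ _) hm
  exact far_axis k hk hp0 hp0' hp1 hp1' hm0 hb.1 hb.2 (hsub.trans hs)

theorem sees_comm {A : Set Plane} {p q : Plane} : Sees A p q ↔ Sees A q p := by
  unfold Sees; rw [segment_symm]

theorem body_neg {k : ℝ} {x : Plane} : -x ∈ body k ↔ x ∈ body k := by
  rw [mem_body, mem_body, neg_neg, or_comm]

theorem sees_neg {k : ℝ} {p q : Plane} (h : Sees (body k) p q) : Sees (body k) (-p) (-q) := by
  rintro x ⟨s, t, hs, ht, hst, rfl⟩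
  rw [← body_neg]
  exact h ⟨s, t, hs, ht, hst, by module⟩

/-- The left half of the vertices. -/
def leftV (k : ℝ) : Set Plane :=
  {x | x = va k ∨ x = vb k ∨ x = vc k ∨ x = vd k ∨ x = ve k ∨ x = s1 k ∨ x = s2 k ∨ x = s3 k ∨
    x = s4 k}

theorem leftV_neg {k : ℝ} (hk : 10 ≤ k) {x : Plane} (h : x ∈ leftV k) : x 0 < 0 := by
  rcases h with rfl | rfl | rfl | rfl | rfl | rfl | rfl | rfl | rfl <;>
    (simp only [coords]; linarith)

theorem sees_w {k : ℝ} (hk : 10 ≤ k) {x : Plane} (hx : x ∈ leftV k ∨ -x ∈ leftV k)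
    (hs : Sees (body k) x (vw k)) : x = vc k ∨ x = vd k ∨ x = ve k := by
  rcases hx with hx | hx
  · rcases hx with rfl | rfl | rfl | rfl | rfl | rfl | rfl | rfl | rfl
    · exact absurd hs (ns_va_w k hk)
    · exact absurd hs (ns_vb_w k hk)
    · simp
    · simp
    · simp
    · exact absurd hs (ns_s1_w k hk)
    · exact absurd hs (ns_s2_w k hk)
    · exact absurd hs (ns_s3_w k hk)
    · exact absurd hs (ns_s4_w k hk)
  · exfalso
    have h0 := leftV_neg hk hx
    simp only [PiLp.neg_apply] at h0
    refine far k hk ?_ ?_ ?_ ?_ (by linarith : 0 ≤ x 0) (sees_comm.1 hs) <;>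
      (simp only [coords]; linarith)

theorem sees_O {k : ℝ} (hk : 10 ≤ k) {x : Plane} (hx : x ∈ leftV k)
    (hs : Sees (body k) x 0) : x = va k ∨ x = vb k := by
  rcases hx with rfl | rfl | rfl | rfl | rfl | rfl | rfl | rfl | rfl
  · simp
  · simp
  · exfalso
    refine far k hk ?_ ?_ ?_ ?_ (by simp : (0 : ℝ) ≤ (0 : Plane) 0) hs <;>
      (simp only [coords]; linarith)
  · exfalso
    refine far k hk ?_ ?_ ?_ ?_ (by simp : (0 : ℝ) ≤ (0 : Plane) 0) hs <;>
      (simp only [coords]; linarith)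
  · exfalso
    refine far k hk ?_ ?_ ?_ ?_ (by simp : (0 : ℝ) ≤ (0 : Plane) 0) hs <;>
      (simp only [coords]; linarith)
  · exact absurd hs (ns_s1_O k hk)
  · exact absurd hs (ns_s2_O k hk)
  · exact absurd hs (ns_s3_O k hk)
  · exact absurd hs (ns_s4_O k hk)

theorem w_mem (k : ℝ) : vw k ∈ body k := by
  rw [mem_body]
  left; left
  simp only [half, mem_union]
  left; left; left; left; right
  rw [mem_tri]
  refine ⟨1 / 10, 3 / 20, 3 / 4, by norm_num, by norm_num, by norm_num, by norm_num, ?_⟩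
  apply plane_ext <;>
  · simp only [PiLp.add_apply, PiLp.smul_apply, smul_eq_mul, coords]; ring

theorem O_mem (k : ℝ) : (0 : Plane) ∈ body k := by
  rw [mem_body]
  left; right
  rw [mem_tri]
  exact ⟨0, 1 / 2, 1 / 2, by norm_num, by norm_num, by norm_num, by norm_num, by module⟩

/-- `e` sees the other vertices of the core. -/
theorem e_sees {k : ℝ} {x : Plane}
    (hx : x = va k ∨ x = vb k ∨ x = vc k ∨ x = vd k ∨ x = ve k) : Sees (body k) x (ve k) := by
  have key : ∀ p q : Plane, tri (ve k) p q ⊆ body k →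
      Sees (body k) p (ve k) ∧ Sees (body k) q (ve k) ∧ Sees (body k) (ve k) (ve k) := by
    intro p q h
    have hc : Convex ℝ (tri (ve k) p q) := convex_convexHull _ _
    have he : ve k ∈ tri (ve k) p q := subset_convexHull _ _ (by simp)
    exact ⟨(hc.segment_subset (subset_convexHull _ _ (by simp)) he).trans h,
      (hc.segment_subset (subset_convexHull _ _ (by simp)) he).trans h,
      (hc.segment_subset he he).trans h⟩
  have k1 := key (va k) (vb k) (fun x hx => by
    rw [mem_body]; left; left; simp only [half, mem_union]; tauto)
  have k2 := key (vc k) (vd k) (fun x hx => by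
    rw [mem_body]; left; left; simp only [half, mem_union]; tauto)
  rcases hx with rfl | rfl | rfl | rfl | rfl
  · exact k1.1
  · exact k1.2.1
  · exact k2.1
  · exact k2.2.1
  · exact k1.2.2

theorem e_dist {k : ℝ} {x : Plane}
    (hx : x = va k ∨ x = vb k ∨ x = vc k ∨ x = vd k ∨ x = ve k) : dist x (ve k) ≤ 20 := by
  rw [EuclideanSpace.dist_eq, Fin.sum_univ_two, Real.sqrt_le_left (by norm_num)]
  simp only [Real.dist_eq, sq_abs]
  rcases hx with rfl | rfl | rfl | rfl | rfl <;> (simp only [coords]; nlinarith)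


theorem geo_le {A : Set Plane} {p e q : Plane} (h1 : Sees A p e) (h2 : Sees A e q) {D : ℝ}
    (hD1 : dist p e ≤ D) (hD2 : dist q e ≤ D) : geodesicDist A p q ≤ ENNReal.ofReal (2 * D) := by
  have hD : 0 ≤ D := dist_nonneg.trans hD1
  let γ : ℝ → Plane := fun t => p + min (2 * t) 1 • (e - p) + max (2 * t - 1) 0 • (q - e)
  have n1 : ‖e - p‖ ≤ D := by rwa [← dist_eq_norm, dist_comm]
  have n2 : ‖q - e‖ ≤ D := by rwa [← dist_eq_norm]
  have hle : ∀ s t : ℝ, s ≤ t → dist (γ s) (γ t) ≤ 2 * D * dist s t := by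
    intro s t hst
    have e1 : γ t - γ s = (min (2 * t) 1 - min (2 * s) 1) • (e - p) +
        (max (2 * t - 1) 0 - max (2 * s - 1) 0) • (q - e) := by
      simp only [γ]; module
    have a1 : 0 ≤ min (2 * t) 1 - min (2 * s) 1 :=
      sub_nonneg.2 (min_le_min_right _ (by linarith))
    have a2 : 0 ≤ max (2 * t - 1) 0 - max (2 * s - 1) 0 :=
      sub_nonneg.2 (max_le_max_right _ (by linarith))
    have a3 : (min (2 * t) 1 - min (2 * s) 1) + (max (2 * t - 1) 0 - max (2 * s - 1) 0)
        = 2 * (t - s) := by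
      have : ∀ u : ℝ, min (2 * u) 1 + max (2 * u - 1) 0 = 2 * u := by
        intro u
        rcases le_total (2 * u) 1 with h | h
        · rw [min_eq_left h, max_eq_right (by linarith)]; ring
        · rw [min_eq_right h, max_eq_left (by linarith)]; ring
      linarith [this s, this t]
    rw [dist_comm, dist_eq_norm, e1, Real.dist_eq, abs_sub_comm, abs_of_nonneg (sub_nonneg.2 hst)]
    refine (norm_add_le _ _).trans ?_
    rw [norm_smul, norm_smul, Real.norm_of_nonneg a1, Real.norm_of_nonneg a2]
    have b1 := mul_le_mul_of_nonneg_left n1 a1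
    have b2 := mul_le_mul_of_nonneg_left n2 a2
    have b3 : D * ((min (2 * t) 1 - min (2 * s) 1) + (max (2 * t - 1) 0 - max (2 * s - 1) 0))
        = D * (2 * (t - s)) := by rw [a3]
    linarith
  have hlip : LipschitzWith (Real.toNNReal (2 * D)) γ := by
    apply LipschitzWith.of_dist_le_mul
    intro s t
    rw [Real.coe_toNNReal _ (by positivity)]
    rcases le_total s t with h | h
    · exact hle s t h
    · rw [dist_comm (γ s), dist_comm s]; exact hle t s h
  have hmaps : MapsTo γ (Icc 0 1) A := by
    intro t ht
    rcases le_total (2 * t) 1 with h | h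
    · apply h1
      refine ⟨1 - 2 * t, 2 * t, by linarith, by linarith [ht.1], by ring, ?_⟩
      simp only [γ]; rw [min_eq_left h, max_eq_right (by linarith)]; module
    · apply h2
      refine ⟨1 - (2 * t - 1), 2 * t - 1, by linarith [ht.2], by linarith, by ring, ?_⟩
      simp only [γ]; rw [min_eq_right h, max_eq_left (by linarith)]; module
  have hg0 : γ 0 = p := by simp [γ]
  have hg1 : γ 1 = q := by
    simp only [γ]; norm_num
  have hvar : eVariationOn γ (Icc 0 1) ≤ ENNReal.ofReal (2 * D) := by
    have := (hlip.lipschitzOnWith (s := univ)).comp_eVariationOn_le (g := id) (s := Icc (0 : ℝ) 1)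
      (fun _ _ => mem_univ _)
    have h3 : eVariationOn (id : ℝ → ℝ) (Icc (0 : ℝ) 1) ≤ ENNReal.ofReal 1 := by
      simp
    refine this.trans ((mul_le_mul_right h3 _).trans ?_)
    simp [ENNReal.ofReal]
  unfold geodesicDist
  exact (iInf_le_of_le γ <| iInf_le_of_le hlip.continuous.continuousOn <| iInf_le_of_le hg0 <|
    iInf_le_of_le hg1 <| iInf_le_of_le hmaps hvar)

theorem sees_smul {A : Set Plane} {p q : Plane} {s : ℝ} (hs : s ≠ 0) :
    Sees ((fun x => s • x) '' A) (s • p) (s • q) ↔ Sees A p q := by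
  constructor
  · rintro h x ⟨a, b, ha, hb, hab, rfl⟩
    obtain ⟨y, hy, he⟩ := h (⟨a, b, ha, hb, hab, rfl⟩ : _ ∈ segment ℝ (s • p) (s • q))
    have : s • y = s • (a • p + b • q) := by
      simp only at he; rw [he]; module
    rwa [← smul_right_injective Plane hs this]
  · rintro h x ⟨a, b, ha, hb, hab, rfl⟩
    exact ⟨a • p + b • q, h ⟨a, b, ha, hb, hab, rfl⟩, by simp only; module⟩

/-- A simple 18-gon from a polygonal region. -/
def mkPoly (A : Set Plane) (W : ZMod 18 → Plane) (inj : Function.Injective W)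
    (h : PR A (List.ofFn (n := 18) (fun i : ZMod 18 => (W i, W (i + 1))))) : SimplePolygon :=
  have meet : ∀ i j : ZMod 18, i ≠ j → MeetOk (W i, W (i + 1)) (W j, W (j + 1)) := by
    intro i j hij
    have hp := List.pairwise_ofFn.1 h.pw
    rcases lt_or_gt_of_ne (show (show Fin 18 from i) ≠ (show Fin 18 from j) from hij) with hl | hl
    · exact hp hl
    · exact (hp hl).symm
  { n := 18
    three_le := by norm_num
    vertex := W
    carrier := A
    isCompact := h.compact
    isConnected := h.conn
    regular := h.reg
    frontier_eq := by
      rw [h.fr]; ext x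
      simp only [bd, mem_ofPred_eq, mem_iUnion]
      constructor
      · rintro ⟨e, he, hx⟩
        obtain ⟨i, rfl⟩ := List.mem_ofFn.1 he
        exact ⟨i, hx⟩
      · rintro ⟨i, hx⟩
        exact ⟨_, List.mem_ofFn.2 ⟨i, rfl⟩, hx⟩
    vertex_injective := inj
    edges_adjacent := by
      intro i
      have hne : i ≠ i + 1 := by revert i; decide
      have hne2 : i ≠ i + 2 := by revert i; decide
      have hs : i + 1 + 1 = i + 2 := by rw [add_assoc]; rfl
      apply Subset.antisymm
      · rintro x ⟨hx, hy⟩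
        rw [← hs] at hy
        have := meet i (i + 1) hne x hx hy
        simp only [hs] at this
        rcases this.1 with h1 | h1
        · rcases this.2 with h2 | h2
          · exact h2
          · exact absurd (inj (h1.symm.trans h2)) hne2
        · exact h1
      · rintro x rfl
        exact ⟨right_mem_segment _ _ _, left_mem_segment _ _ _⟩
    edges_disjoint := by
      intro i j h1 h2 h3
      rw [Set.disjoint_left]
      intro x hx hy
      obtain ⟨a | a, b | b⟩ := meet i j h1 x hx hy
      · exact h1 (inj (a.symm.trans b))
      · exact h3 (inj (b.symm.trans a))
      · exact h2 (inj (a.symm.trans b))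
      · exact h1 (add_right_cancel (inj (a.symm.trans b))) }

/-- The vertices of the unscaled polygon in cyclic order. -/
def W (k : ℝ) : Fin 18 → Plane :=
  ![-(va k), vb k, s1 k, vc k, s2 k, vd k, s3 k, ve k, s4 k,
    va k, -(vb k), -(s1 k), -(vc k), -(s2 k), -(vd k), -(s3 k), -(ve k), -(s4 k)]

/-- The vertices in the order of a linear functional. -/
def U (k : ℝ) : Fin 18 → Plane :=
  ![-(s2 k), -(s1 k), s4 k, s3 k, -(vd k), -(ve k), -(vc k), -(vb k), -(va k),
    va k, vb k, vc k, ve k, vd k, -(s3 k), -(s4 k), s1 k, s2 k]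

/-- The reordering. -/
def σσ : Fin 18 → Fin 18 := ![8, 10, 16, 11, 17, 13, 3, 12, 2, 9, 7, 1, 6, 0, 4, 14, 5, 15]

theorem W_inj (k : ℝ) (hk : 10 ≤ k) : Function.Injective (W k) := by
  have hmono : StrictMono (fun i => 10 * k * U k i 1 - U k i 0) := by
    rw [Fin.strictMono_iff_lt_succ]
    intro i
    fin_cases i <;> simp [U, coords] <;> nlinarith
  have hU : Function.Injective (U k) := by
    intro i j h
    apply hmono.injective
    simp only [h]
  have hσ : Function.Injective σσ := by decide
  have hW : W k = U k ∘ σσ := by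
    funext i; fin_cases i <;> rfl
  rw [hW]
  exact hU.comp hσ

theorem PR_W (k : ℝ) (hk : 10 ≤ k) :
    PR (body k) (List.ofFn (fun i : Fin 18 => (W k i, W k (i + 1)))) := PR_body k hk

theorem W_left (k : ℝ) (i : Fin 18) : W k i ∈ leftV k ∨ -(W k i) ∈ leftV k := by
  fin_cases i <;> simp [W, leftV]

theorem edge_len (k : ℝ) (hk : 10 ≤ k) (i : Fin 18) :
    650 * k - 40 ≤ dist (W k i) (W k (i + 1)) ∧ dist (W k i) (W k (i + 1)) ≤ 650 * k + 40 := by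
  rw [EuclideanSpace.dist_eq, Fin.sum_univ_two]
  rw [Real.le_sqrt' (by linarith), Real.sqrt_le_left (by linarith)]
  simp only [Real.dist_eq, sq_abs]
  fin_cases i <;> simp [W, coords] <;> constructor <;> nlinarith


theorem pair_close {k s : ℝ} (hs : 0 < s) {x y : Plane}
    (hx : x = va k ∨ x = vb k ∨ x = vc k ∨ x = vd k ∨ x = ve k)
    (hy : y = va k ∨ y = vb k ∨ y = vc k ∨ y = vd k ∨ y = ve k) :
    geodesicDist ((fun x => s • x) '' body k) (s • x) (s • y) ≤ ENNReal.ofReal (2 * (s * 20)) ∧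
    geodesicDist ((fun x => s • x) '' body k) (s • (-x)) (s • (-y)) ≤
      ENNReal.ofReal (2 * (s * 20)) := by
  have dx := mul_le_mul_of_nonneg_left (e_dist hx) hs.le
  have dy := mul_le_mul_of_nonneg_left (e_dist hy) hs.le
  constructor
  · refine geo_le (e := s • ve k) ((sees_smul hs.ne').2 (e_sees hx))
      ((sees_smul hs.ne').2 (sees_comm.1 (e_sees hy))) ?_ ?_
    · rwa [dist_smul₀, Real.norm_of_nonneg hs.le]
    · rwa [dist_smul₀, Real.norm_of_nonneg hs.le]
  · refine geo_le (e := s • (-(ve k))) ((sees_smul hs.ne').2 (sees_neg (e_sees hx)))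
      ((sees_smul hs.ne').2 (sees_neg (sees_comm.1 (e_sees hy)))) ?_ ?_
    · rwa [dist_smul₀, Real.norm_of_nonneg hs.le, dist_neg_neg]
    · rwa [dist_smul₀, Real.norm_of_nonneg hs.le, dist_neg_neg]

theorem core_ne {k : ℝ} {x y : Plane} (hx : x = va k ∨ x = vb k)
    (hy : y = vc k ∨ y = vd k ∨ y = ve k) : x ≠ y := by
  intro h
  have h1 : x 1 = y 1 := by rw [h]
  rcases hx with rfl | rfl <;> rcases hy with rfl | rfl | rfl <;>
    (simp only [coords] at h1; norm_num at h1)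


/-- For every `ε > 0` there is a simple polygon all of whose
boundary edges have Euclidean length between `1` and `1 + ε`, such that every
vertex guard set contains two distinct guards at geodesic distance
less than `ε`. -/
theorem exists_polygon_small_dispersion_long_edges (ε : ℝ) (hε : 0 < ε) :
    ∃ P : SimplePolygon,
      (∀ i : ZMod P.n, 1 ≤ dist (P.vertex i) (P.vertex (i + 1)) ∧
        dist (P.vertex i) (P.vertex (i + 1)) ≤ 1 + ε) ∧
      ∀ G : Set Plane, P.IsVertexGuardSet G →
        ∃ g ∈ G, ∃ h ∈ G, g ≠ h ∧
          geodesicDist P.carrier g h < ENNReal.ofReal ε := by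
  set k : ℝ := 10 + 1 / ε with hkdef
  have hk : 10 ≤ k := by
    have : 0 < 1 / ε := by positivity
    linarith
  have hkε : ε * k = 10 * ε + 1 := by rw [hkdef]; field_simp
  have hL : 0 < 650 * k - 40 := by linarith
  set s : ℝ := (650 * k - 40)⁻¹ with hsdef
  have hs : 0 < s := inv_pos.2 hL
  have hsL : s * (650 * k - 40) = 1 := inv_mul_cancel₀ hL.ne'
  have hsε : 80 * s < ε := by
    have h1 : 80 < ε * (650 * k - 40) := by nlinarith
    have h2 := mul_lt_mul_of_pos_left h1 hs
    nlinarith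
  have hfin : ENNReal.ofReal (2 * (s * 20)) < ENNReal.ofReal ε :=
    (ENNReal.ofReal_lt_ofReal_iff hε).2 (by linarith)
  have hinj : Function.Injective (fun i : Fin 18 => s • W k i) :=
    (smul_right_injective Plane hs.ne').comp (W_inj k hk)
  have hPR : PR ((fun x => s • x) '' body k)
      (List.ofFn (fun i : Fin 18 => (s • W k i, s • W k (i + 1)))) := by
    have := (PR_W k hk).smul hs.ne'
    rwa [List.map_ofFn] at this
  refine ⟨mkPoly ((fun x => s • x) '' body k) (fun i : Fin 18 => s • W k i) hinj hPR, ?_, ?_⟩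
  · intro (i : Fin 18)
    change 1 ≤ dist (s • W k i) (s • W k (i + 1)) ∧ dist (s • W k i) (s • W k (i + 1)) ≤ 1 + ε
    rw [dist_smul₀, Real.norm_of_nonneg hs.le]
    obtain ⟨h1, h2⟩ := edge_len k hk i
    have h3 := mul_le_mul_of_nonneg_left h1 hs.le
    have h4 := mul_le_mul_of_nonneg_left h2 hs.le
    constructor <;> linarith
  · intro G hG
    change ∃ g ∈ G, ∃ h ∈ G, g ≠ h ∧
      geodesicDist ((fun x => s • x) '' body k) g h < ENNReal.ofReal ε
    have hrange : G ⊆ Set.range (fun i : Fin 18 => s • W k i) := hG.1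
    have hguard : ∀ x ∈ (fun x => s • x) '' body k, ∃ g ∈ G,
        Sees ((fun x => s • x) '' body k) g x := hG.2.2
    have hsee : ∀ x ∈ body k, ∃ y, (y ∈ leftV k ∨ -y ∈ leftV k) ∧ s • y ∈ G ∧
        Sees (body k) y x := by
      intro x hx
      obtain ⟨g, hg, hgx⟩ := hguard (s • x) ⟨x, hx, rfl⟩
      obtain ⟨i, rfl⟩ := hrange hg
      exact ⟨W k i, W_left k i, hg, (sees_smul hs.ne').1 hgx⟩
    obtain ⟨y, hy, hyG, hyO⟩ := hsee 0 (O_mem k)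
    have hinj' := smul_right_injective Plane hs.ne'
    rcases hy with hy | hy
    · have hya := sees_O hk hy hyO
      obtain ⟨x, hx, hxG, hxw⟩ := hsee (vw k) (w_mem k)
      have hxc := sees_w hk hx hxw
      refine ⟨s • y, hyG, s • x, hxG, fun h => core_ne hya hxc (hinj' h), ?_⟩
      exact (pair_close hs (by tauto) (by tauto)).1.trans_lt hfin
    · have hya := sees_O hk hy (by simpa using sees_neg hyO)
      obtain ⟨x, hx, hxG, hxw⟩ := hsee (-(vw k)) (body_neg.2 (w_mem k))
      have hxc := sees_w (x := -x) hk (by rw [neg_neg]; tauto) (by simpa using sees_neg hxw)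
      refine ⟨s • y, hyG, s • x, hxG, fun h => core_ne hya hxc (by rw [hinj' h]), ?_⟩
      have := (pair_close hs (x := -y) (y := -x) (by tauto) (by tauto)).2.trans_lt hfin
      simpa using this
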